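/- Assume f : 𝒳ⁿ × ℝᵐ → ℝⁿ is Lipschitz on bounded sets with f(0,0) = 0. The following are equivalent: (1) the system ẋ(t) = f(x_t, u(t)) is iISS; (2) the system is 0-GAS and satisfies the UBEBS property with c = 0; (3) the system is 0-GAS and satisfies the UBEBS property (with some c ≥ 0). -/

import Mathlib

open Set Filter MeasureTheory Topology
open scoped NNReal

noncomputable section

/-- `ℝⁿ` with the Euclidean norm. -/
abbrev Vec (n : ℕ) : Type := EuclideanSpace ℝ (Fin n)

/-- The state space `𝒳ⁿ = C([-Δ,0], ℝⁿ)`, equipped with the sup norm. -/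
abbrev Hist (Δ : ℝ≥0) (n : ℕ) : Type :=
  ContinuousMap (Icc (-(Δ : ℝ)) (0 : ℝ)) (Vec n)

theorem zero_mem_IccD (Δ : ℝ≥0) : (0 : ℝ) ∈ Icc (-(Δ : ℝ)) (0 : ℝ) :=
  ⟨neg_nonpos.mpr Δ.coe_nonneg, le_refl 0⟩

/-- `φ(0)`: the current value of a history segment. -/
def ev0 {Δ : ℝ≥0} {n : ℕ} (φ : Hist Δ n) : Vec n :=
  φ ⟨0, zero_mem_IccD Δ⟩

/-! ### Comparison functions -/

/-- Class `𝒦`: continuous, strictly increasing, zero at zero (on `[0,∞)`). -/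
def ClassK (α : ℝ → ℝ) : Prop :=
  ContinuousOn α (Ici 0) ∧ StrictMonoOn α (Ici 0) ∧ α 0 = 0

/-- Class `𝒦∞`: class `𝒦` and unbounded. -/
def ClassKinf (α : ℝ → ℝ) : Prop :=
  ClassK α ∧ Tendsto α atTop atTop

/-- Class `𝒩`: continuous, nondecreasing, zero at zero (on `[0,∞)`). -/
def ClassN (α : ℝ → ℝ) : Prop :=
  ContinuousOn α (Ici 0) ∧ MonotoneOn α (Ici 0) ∧ α 0 = 0

/-- Class `𝒫`: continuous, zero at zero, positive on `(0,∞)`. -/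
def ClassP (α : ℝ → ℝ) : Prop :=
  ContinuousOn α (Ici 0) ∧ α 0 = 0 ∧ ∀ s : ℝ, 0 < s → 0 < α s

/-- Class `𝒦ℒ`. -/
def ClassKL (β : ℝ → ℝ → ℝ) : Prop :=
  (∀ t : ℝ, 0 ≤ t → ClassK fun s => β s t) ∧
    ∀ s : ℝ, 0 ≤ s →
      ContinuousOn (β s) (Ici 0) ∧ AntitoneOn (β s) (Ici 0) ∧
        Tendsto (β s) atTop (𝓝 0)

/-! ### Inputs -/

/-- Admissible input: Lebesgue measurable and locally essentially bounded. -/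
def IsInput {m : ℕ} (u : ℝ → Vec m) : Prop :=
  Measurable u ∧ ∀ T : ℝ, 0 < T → ∃ C : ℝ, ∀ᵐ t ∂volume, t ∈ Icc (0 : ℝ) T → ‖u t‖ ≤ C

/-- Essential supremum of `‖u‖` over a set of times. -/
def essBnd {m : ℕ} (u : ℝ → Vec m) (s : Set ℝ) : ℝ :=
  sInf {C : ℝ | 0 ≤ C ∧ ∀ᵐ τ ∂volume, τ ∈ s → ‖u τ‖ ≤ C}

/-! ### History segments along a trajectory -/

-- The history segment `x_t ∈ 𝒳ⁿ` of a trajectory `x : ℝ → ℝⁿ` (with junk value `0`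
-- when `x` is not continuous on `[t-Δ, t]`).
open Classical in
def seg (Δ : ℝ≥0) {n : ℕ} (x : ℝ → Vec n) (t : ℝ) : Hist Δ n :=
  if hx : ContinuousOn x (Icc (t - (Δ : ℝ)) t) then
    { toFun := fun τ => x (t + τ.1)
      continuous_toFun := by
        have h1 : Continuous fun τ : Icc (-(Δ : ℝ)) (0 : ℝ) => t + τ.1 :=
          continuous_const.add continuous_subtype_val
        have h2 : ∀ τ : Icc (-(Δ : ℝ)) (0 : ℝ), t + τ.1 ∈ Icc (t - (Δ : ℝ)) t := by
          rintro ⟨τ, hτ⟩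
          rw [mem_Icc] at hτ ⊢
          constructor
          · linarith [hτ.1]
          · linarith [hτ.2]
        exact hx.comp_continuous h1 h2 }
  else 0

/-! ### Driver's derivative and Dini derivative -/

/-- The deformed history `φ_{h,w}` appearing in Driver's derivative: for `0 ≤ h < Δ`,
`φ_{h,w}(s) = φ(s+h)` for `s ∈ [-Δ,-h)` and `φ_{h,w}(s) = φ(0) + w(h+s)` for `s ∈ [-h,0]`. -/
def shiftSeg {Δ : ℝ≥0} {n : ℕ} (φ : Hist Δ n) (w : Vec n) (h : ℝ) : Hist Δ n :=
  { toFun := fun s =>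
      φ (projIcc (-(Δ : ℝ)) 0 (neg_nonpos.mpr Δ.coe_nonneg) (s.1 + h)) + max (h + s.1) 0 • w
    continuous_toFun := by
      refine Continuous.add ?_ ?_
      · exact φ.continuous.comp (continuous_projIcc.comp
          (continuous_subtype_val.add continuous_const))
      · exact ((continuous_const.add continuous_subtype_val).max continuous_const).smul
          continuous_const }

/-- Driver's derivative `D⁺V(φ,w)`, valued in the extended reals. -/
def driverD {Δ : ℝ≥0} {n : ℕ} (V : Hist Δ n → ℝ) (φ : Hist Δ n) (w : Vec n) : EReal :=
  limsup (fun h : ℝ => (((V (shiftSeg φ w h) - V φ) / h : ℝ) : EReal)) (𝓝[>] (0 : ℝ))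

/-- Upper right-hand Dini derivative of `ν : ℝ → ℝ`, valued in the extended reals. -/
def diniD (ν : ℝ → ℝ) (t : ℝ) : EReal :=
  limsup (fun h : ℝ => (((ν (t + h) - ν t) / h : ℝ) : EReal)) (𝓝[>] (0 : ℝ))

/-! ### Lipschitz conditions -/

/-- `f : 𝒳ⁿ × ℝᵐ → ℝⁿ` is Lipschitz on bounded sets. -/
def LipOnBounded {Δ : ℝ≥0} {n m : ℕ} (f : Hist Δ n → Vec m → Vec n) : Prop :=
  ∀ r : ℝ, 0 < r → ∃ L : ℝ, 0 < L ∧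
    ∀ (φ₁ φ₂ : Hist Δ n) (v₁ v₂ : Vec m),
      ‖φ₁‖ ≤ r → ‖φ₂‖ ≤ r → ‖v₁‖ ≤ r → ‖v₂‖ ≤ r →
        ‖f φ₁ v₁ - f φ₂ v₂‖ ≤ L * (‖φ₁ - φ₂‖ + ‖v₁ - v₂‖)

/-- An input-free vector field `f₀ : 𝒳ⁿ → ℝⁿ` Lipschitz on bounded sets. -/
def LipOnBounded₀ {Δ : ℝ≥0} {n : ℕ} (f₀ : Hist Δ n → Vec n) : Prop :=
  ∀ r : ℝ, 0 < r → ∃ L : ℝ, 0 < L ∧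
    ∀ φ₁ φ₂ : Hist Δ n, ‖φ₁‖ ≤ r → ‖φ₂‖ ≤ r → ‖f₀ φ₁ - f₀ φ₂‖ ≤ L * ‖φ₁ - φ₂‖

/-- A functional `V : 𝒳ⁿ → ℝ` Lipschitz on bounded sets. -/
def LipOnBoundedV {Δ : ℝ≥0} {n : ℕ} (V : Hist Δ n → ℝ) : Prop :=
  ∀ r : ℝ, 0 < r → ∃ L : ℝ, 0 < L ∧
    ∀ φ₁ φ₂ : Hist Δ n, ‖φ₁‖ ≤ r → ‖φ₂‖ ≤ r → |V φ₁ - V φ₂| ≤ L * ‖φ₁ - φ₂‖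

/-- A functional `V : 𝒳ⁿ → ℝ` locally Lipschitz. -/
def LocallyLipV {Δ : ℝ≥0} {n : ℕ} (V : Hist Δ n → ℝ) : Prop :=
  ∀ φ : Hist Δ n, ∃ δ : ℝ, 0 < δ ∧ ∃ L : ℝ, 0 < L ∧
    ∀ φ₁ φ₂ : Hist Δ n, ‖φ₁ - φ‖ ≤ δ → ‖φ₂ - φ‖ ≤ δ → |V φ₁ - V φ₂| ≤ L * ‖φ₁ - φ₂‖

/-! ### Solutions -/

/-- `x` is a solution of `ẋ(t) = f(x_t, u(t))` with initial state `x₀` on `[0, tmax)`. -/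
structure IsSolution (Δ : ℝ≥0) {n m : ℕ} (f : Hist Δ n → Vec m → Vec n)
    (u : ℝ → Vec m) (x₀ : Hist Δ n) (tmax : EReal) (x : ℝ → Vec n) : Prop where
  tmax_pos : 0 < tmax
  cont : ContinuousOn x {s : ℝ | -(Δ : ℝ) ≤ s ∧ (s : EReal) < tmax}
  init : ∀ τ : Icc (-(Δ : ℝ)) (0 : ℝ), x τ.1 = x₀ τ
  integrable : ∀ t : ℝ, 0 ≤ t → (t : EReal) < tmax →
    IntervalIntegrable (fun s => f (seg Δ x s) (u s)) volume 0 t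
  integral_eq : ∀ t : ℝ, 0 ≤ t → (t : EReal) < tmax →
    x t = x 0 + ∫ s in (0:ℝ)..t, f (seg Δ x s) (u s)

/-- Maximal solution: a solution admitting no proper extension. -/
def IsMaxSolution (Δ : ℝ≥0) {n m : ℕ} (f : Hist Δ n → Vec m → Vec n)
    (u : ℝ → Vec m) (x₀ : Hist Δ n) (tmax : EReal) (x : ℝ → Vec n) : Prop :=
  IsSolution Δ f u x₀ tmax x ∧
    ∀ (tmax' : EReal) (x' : ℝ → Vec n), IsSolution Δ f u x₀ tmax' x' →
      (∀ t : ℝ, -(Δ : ℝ) ≤ t → (t : EReal) < tmax → x' t = x t) → tmax' ≤ tmax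

/-- Solution of the input-free system `ẋ(t) = f₀(x_t)`. -/
def IsSolution₀ (Δ : ℝ≥0) {n : ℕ} (f₀ : Hist Δ n → Vec n) (x₀ : Hist Δ n)
    (tmax : EReal) (x : ℝ → Vec n) : Prop :=
  IsSolution Δ (fun φ (_ : Vec 0) => f₀ φ) (fun _ => 0) x₀ tmax x

/-- Maximal solution of the input-free system `ẋ(t) = f₀(x_t)`. -/
def IsMaxSolution₀ (Δ : ℝ≥0) {n : ℕ} (f₀ : Hist Δ n → Vec n) (x₀ : Hist Δ n)
    (tmax : EReal) (x : ℝ → Vec n) : Prop :=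
  IsMaxSolution Δ (fun φ (_ : Vec 0) => f₀ φ) (fun _ => 0) x₀ tmax x

/-! ### Stability properties (input-free systems) -/

/-- Global asymptotic stability (GAS). -/
def GAS (Δ : ℝ≥0) {n : ℕ} (f₀ : Hist Δ n → Vec n) : Prop :=
  ∃ β : ℝ → ℝ → ℝ, ClassKL β ∧
    ∀ (x₀ : Hist Δ n) (tmax : EReal) (x : ℝ → Vec n),
      IsMaxSolution₀ Δ f₀ x₀ tmax x →
        tmax = ⊤ ∧ ∀ t : ℝ, 0 ≤ t → ‖x t‖ ≤ β ‖x₀‖ t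

/-- Global exponential stability (GES). -/
def GES (Δ : ℝ≥0) {n : ℕ} (f₀ : Hist Δ n → Vec n) : Prop :=
  ∃ k : ℝ, 1 ≤ k ∧ ∃ lam : ℝ, 0 < lam ∧
    ∀ (x₀ : Hist Δ n) (tmax : EReal) (x : ℝ → Vec n),
      IsMaxSolution₀ Δ f₀ x₀ tmax x →
        tmax = ⊤ ∧ ∀ t : ℝ, 0 ≤ t → ‖x t‖ ≤ k * ‖x₀‖ * Real.exp (-lam * t)

/-- (Local) asymptotic stability (AS) of the origin. -/
def AS (Δ : ℝ≥0) {n : ℕ} (f₀ : Hist Δ n → Vec n) : Prop :=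
  ∃ r : ℝ, 0 < r ∧ ∃ β : ℝ → ℝ → ℝ, ClassKL β ∧
    ∀ (x₀ : Hist Δ n) (tmax : EReal) (x : ℝ → Vec n),
      IsMaxSolution₀ Δ f₀ x₀ tmax x → ‖x₀‖ ≤ r →
        tmax = ⊤ ∧ ∀ t : ℝ, 0 ≤ t → ‖x t‖ ≤ β ‖x₀‖ t

/-- (Local) exponential stability (ES) of the origin. -/
def ES (Δ : ℝ≥0) {n : ℕ} (f₀ : Hist Δ n → Vec n) : Prop :=
  ∃ r : ℝ, 0 < r ∧ ∃ k : ℝ, 1 ≤ k ∧ ∃ lam : ℝ, 0 < lam ∧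
    ∀ (x₀ : Hist Δ n) (tmax : EReal) (x : ℝ → Vec n),
      IsMaxSolution₀ Δ f₀ x₀ tmax x → ‖x₀‖ ≤ r →
        tmax = ⊤ ∧ ∀ t : ℝ, 0 ≤ t → ‖x t‖ ≤ k * ‖x₀‖ * Real.exp (-lam * t)

/-! ### Forward completeness -/

/-- Robust forward completeness (RFC) of `ẋ(t) = f(x_t,u(t))`. -/
def RFC (Δ : ℝ≥0) {n m : ℕ} (f : Hist Δ n → Vec m → Vec n) : Prop :=
  (∀ (x₀ : Hist Δ n) (u : ℝ → Vec m) (tmax : EReal) (x : ℝ → Vec n),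
      IsInput u → IsMaxSolution Δ f u x₀ tmax x → tmax = ⊤) ∧
    ∀ T : ℝ, 0 < T → ∀ r : ℝ, 0 < r → ∃ C : ℝ,
      ∀ (x₀ : Hist Δ n) (u : ℝ → Vec m) (tmax : EReal) (x : ℝ → Vec n),
        IsInput u → IsMaxSolution Δ f u x₀ tmax x →
          ‖x₀‖ ≤ r → essBnd u (Ici 0) ≤ r →
            ∀ t : ℝ, t ∈ Icc (0 : ℝ) T → ‖seg Δ x t‖ ≤ C

/-- Robust forward completeness of the input-free system `ẋ(t) = f₀(x_t)`. -/
def RFC₀ (Δ : ℝ≥0) {n : ℕ} (f₀ : Hist Δ n → Vec n) : Prop :=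
  RFC Δ (fun φ (_ : Vec 0) => f₀ φ)

/-! ### Input-to-state stability notions -/

/-- Input-to-state stability (ISS). -/
def ISS (Δ : ℝ≥0) {n m : ℕ} (f : Hist Δ n → Vec m → Vec n) : Prop :=
  ∃ β : ℝ → ℝ → ℝ, ∃ μ : ℝ → ℝ, ClassKL β ∧ ClassN μ ∧
    ∀ (x₀ : Hist Δ n) (u : ℝ → Vec m) (tmax : EReal) (x : ℝ → Vec n),
      IsInput u → IsMaxSolution Δ f u x₀ tmax x →
        tmax = ⊤ ∧ ∀ t : ℝ, 0 ≤ t → ‖x t‖ ≤ β ‖x₀‖ t + μ (essBnd u (Icc 0 t))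

/-- Local input-to-state stability (LISS). -/
def LISS (Δ : ℝ≥0) {n m : ℕ} (f : Hist Δ n → Vec m → Vec n) : Prop :=
  ∃ r : ℝ, 0 < r ∧ ∃ β : ℝ → ℝ → ℝ, ∃ μ : ℝ → ℝ, ClassKL β ∧ ClassN μ ∧
    ∀ (x₀ : Hist Δ n) (u : ℝ → Vec m) (tmax : EReal) (x : ℝ → Vec n),
      IsInput u → IsMaxSolution Δ f u x₀ tmax x →
        ‖x₀‖ ≤ r → essBnd u (Ici 0) ≤ r →
          tmax = ⊤ ∧ ∀ t : ℝ, 0 ≤ t → ‖x t‖ ≤ β ‖x₀‖ t + μ (essBnd u (Icc 0 t))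

/-- Integral input-to-state stability (iISS). -/
def iISS (Δ : ℝ≥0) {n m : ℕ} (f : Hist Δ n → Vec m → Vec n) : Prop :=
  ∃ β : ℝ → ℝ → ℝ, ∃ η μ : ℝ → ℝ, ClassKL β ∧ ClassN η ∧ ClassN μ ∧
    ∀ (x₀ : Hist Δ n) (u : ℝ → Vec m) (tmax : EReal) (x : ℝ → Vec n),
      IsInput u → IsMaxSolution Δ f u x₀ tmax x →
        tmax = ⊤ ∧ ∀ t : ℝ, 0 ≤ t →
          ‖x t‖ ≤ β ‖x₀‖ t + η (∫ s in (0:ℝ)..t, μ ‖u s‖)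

/-- The UBEBS estimate with offset `c`. -/
def UBEBSwith (Δ : ℝ≥0) {n m : ℕ} (f : Hist Δ n → Vec m → Vec n) (c : ℝ) : Prop :=
  ∃ α ξ ζ : ℝ → ℝ, ClassKinf α ∧ ClassKinf ξ ∧ ClassKinf ζ ∧
    ∀ (x₀ : Hist Δ n) (u : ℝ → Vec m) (tmax : EReal) (x : ℝ → Vec n),
      IsInput u → IsMaxSolution Δ f u x₀ tmax x →
        tmax = ⊤ ∧ ∀ t : ℝ, 0 ≤ t →
          α ‖x t‖ ≤ ξ ‖x₀‖ + (∫ s in (0:ℝ)..t, ζ ‖u s‖) + c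

/-! ### Lyapunov–Krasovskii functionals -/

/-- Lyapunov–Krasovskii functional candidate (LKF). -/
def IsLKF {Δ : ℝ≥0} {n : ℕ} (V : Hist Δ n → ℝ) : Prop :=
  (∀ φ, 0 ≤ V φ) ∧ LipOnBoundedV V ∧
    ∃ α₁ α₂ : ℝ → ℝ, ClassKinf α₁ ∧ ClassKinf α₂ ∧
      ∀ φ : Hist Δ n, α₁ ‖ev0 φ‖ ≤ V φ ∧ V φ ≤ α₂ ‖φ‖

/-- Coercive Lyapunov–Krasovskii functional candidate. -/
def IsCoerciveLKF {Δ : ℝ≥0} {n : ℕ} (V : Hist Δ n → ℝ) : Prop :=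
  (∀ φ, 0 ≤ V φ) ∧ LipOnBoundedV V ∧
    ∃ α₁ α₂ : ℝ → ℝ, ClassKinf α₁ ∧ ClassKinf α₂ ∧
      ∀ φ : Hist Δ n, α₁ ‖φ‖ ≤ V φ ∧ V φ ≤ α₂ ‖φ‖

end

theorem ClassKinf.exists_inverse {α : ℝ → ℝ} (hα : ClassKinf α) :
    ∃ γ : ℝ → ℝ, ClassKinf γ ∧ (∀ s, 0 ≤ s → α (γ s) = s) ∧ ∀ s, 0 ≤ s → γ (α s) = s := by
  obtain ⟨⟨hc, hm, h0⟩, ht⟩ := hα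
  let g : ℝ → ℝ := fun s => α (max s 0) + min s 0
  have gpos : ∀ s, 0 ≤ s → g s = α s := fun s hs => by simp [g, hs]
  have gneg : ∀ s, s ≤ 0 → g s = s := fun s hs => by simp [g, hs, h0]
  have hgc : Continuous g :=
    (hc.comp_continuous (continuous_id.max continuous_const) fun s => le_max_right s 0).add
      (continuous_id.min continuous_const)
  have hgm : StrictMono g := by
    intro a b hab
    rcases le_total 0 a with ha | ha
    · rw [gpos a ha, gpos b (ha.trans hab.le)]
      exact hm ha (ha.trans hab.le) hab
    · rw [gneg a ha]
      rcases le_total b 0 with hb | hb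
      · rwa [gneg b hb]
      · rw [gpos b hb]
        rcases hb.eq_or_lt with rfl | hb'
        · rwa [h0]
        · exact ha.trans_lt (h0 ▸ hm (mem_Ici.2 le_rfl) hb hb')
  have hgt : Tendsto g atTop atTop :=
    ht.congr' (by filter_upwards [eventually_ge_atTop 0] with s hs using (gpos s hs).symm)
  have hgb : Tendsto g atBot atBot :=
    tendsto_id.congr' (by filter_upwards [eventually_le_atBot 0] with s hs using (gneg s hs).symm)
  let e : ℝ ≃o ℝ := hgm.orderIsoOfSurjective g (hgc.surjective hgt hgb)
  have he : ∀ s, e s = g s := fun s => rfl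
  have e0 : e.symm 0 = 0 := by rw [OrderIso.symm_apply_eq, he, gneg 0 le_rfl]
  have enn : ∀ s, 0 ≤ s → 0 ≤ e.symm s := fun s hs => e0 ▸ e.symm.monotone hs
  refine ⟨e.symm, ⟨⟨e.symm.continuous.continuousOn, e.symm.strictMono.strictMonoOn _, e0⟩,
    e.symm.tendsto_atTop⟩, fun s hs => ?_, fun s hs => ?_⟩
  · rw [← gpos _ (enn s hs), ← he, e.apply_symm_apply]
  · rw [← gpos s hs, ← he, e.symm_apply_apply]

theorem ClassK.nonneg {α : ℝ → ℝ} (hα : ClassK α) {s : ℝ} (hs : 0 ≤ s) : 0 ≤ α s :=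
  hα.2.2 ▸ hα.2.1.monotoneOn (mem_Ici.2 le_rfl) hs hs

theorem ClassK.mono {α : ℝ → ℝ} (hα : ClassK α) {s t : ℝ} (hs : 0 ≤ s) (hst : s ≤ t) :
    α s ≤ α t :=
  hα.2.1.monotoneOn hs (hs.trans hst) hst

theorem ClassK.classN {α : ℝ → ℝ} (hα : ClassK α) : ClassN α :=
  ⟨hα.1, hα.2.1.monotoneOn, hα.2.2⟩

theorem ClassK.pos {α : ℝ → ℝ} (hα : ClassK α) {s : ℝ} (hs : 0 < s) : 0 < α s :=
  hα.2.2 ▸ hα.2.1 (mem_Ici.2 le_rfl) hs.le hs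

theorem ClassK.exists_pos_le {α : ℝ → ℝ} (hα : ClassK α) {ε : ℝ} (hε : 0 < ε) :
    ∃ δ, 0 < δ ∧ α δ ≤ ε := by
  have h := (hα.1 0 (mem_Ici.2 le_rfl)).tendsto
  rw [hα.2.2] at h
  have h1 : ∀ᶠ s in 𝓝[>] (0 : ℝ), α s < ε :=
    (h.mono_left (nhdsWithin_mono 0 Ioi_subset_Ici_self)).eventually_lt_const hε
  obtain ⟨δ, h1, h2⟩ := (h1.and self_mem_nhdsWithin).exists
  exact ⟨δ, h2, h1.le⟩

theorem ClassN.nonneg {μ : ℝ → ℝ} (hμ : ClassN μ) {s : ℝ} (hs : 0 ≤ s) : 0 ≤ μ s :=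
  hμ.2.2 ▸ hμ.2.1 (mem_Ici.2 le_rfl) hs hs

/-- Adding the identity to a class `𝒩` function gives a class `𝒦∞` function. -/
theorem ClassN.add_id {μ : ℝ → ℝ} (hμ : ClassN μ) : ClassKinf fun s => μ s + s := by
  refine ⟨⟨hμ.1.add continuousOn_id, fun a ha b hb hab => ?_, by simp [hμ.2.2]⟩, ?_⟩
  · exact add_lt_add_of_le_of_lt (hμ.2.1 ha hb hab.le) hab
  · refine tendsto_atTop_mono' _ ?_ tendsto_id
    filter_upwards [eventually_ge_atTop 0] with s hs
    simpa using hμ.nonneg hs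

theorem ClassN.add {μ ν : ℝ → ℝ} (hμ : ClassN μ) (hν : ClassN ν) :
    ClassN fun s => μ s + ν s :=
  ⟨hμ.1.add hν.1, fun _ ha _ hb hab => add_le_add (hμ.2.1 ha hb hab) (hν.2.1 ha hb hab),
    by simp [hμ.2.2, hν.2.2]⟩

theorem ClassKinf.comp {α γ : ℝ → ℝ} (hα : ClassKinf α) (hγ : ClassKinf γ) :
    ClassKinf fun s => α (γ s) := by
  have hn : MapsTo γ (Ici 0) (Ici 0) := fun s hs => hγ.1.nonneg hs
  exact ⟨⟨hα.1.1.comp hγ.1.1 hn, hα.1.2.1.comp hγ.1.2.1 hn, by simp [hγ.1.2.2, hα.1.2.2]⟩,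
    hα.2.comp hγ.2⟩

theorem classKinf_two_mul : ClassKinf fun s => 2 * s :=
  ⟨⟨by fun_prop, fun a _ b _ h => by simpa using h, by simp⟩,
    tendsto_id.const_mul_atTop two_pos⟩

theorem ClassK.map_add_le {α : ℝ → ℝ} (hα : ClassK α) {a b : ℝ} (ha : 0 ≤ a) (hb : 0 ≤ b) :
    α (a + b) ≤ α (2 * a) + α (2 * b) := by
  rcases le_total a b with h | h
  · have := hα.mono (s := a + b) (t := 2 * b) (by positivity) (by linarith)
    linarith [hα.nonneg (s := 2 * a) (by positivity)]
  · have := hα.mono (s := a + b) (t := 2 * a) (by positivity) (by linarith)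
    linarith [hα.nonneg (s := 2 * b) (by positivity)]

theorem iSup_le_iSup_add {ι : Type*} {g k : ι → ℝ} {d : ℝ} (hk : BddAbove (range k))
    (hk0 : ∀ i, 0 ≤ k i) (hd : 0 ≤ d) (h : ∀ i, g i ≤ k i + d) : ⨆ i, g i ≤ (⨆ i, k i) + d :=
  Real.iSup_le (fun i => (h i).trans (by linarith [le_ciSup hk i]))
    (add_nonneg (Real.iSup_nonneg hk0) hd)

theorem continuousOn_of_abs_sub_le {g : ℝ → ℝ} {s : Set ℝ} {K : ℝ} (hK : 0 ≤ K)
    (h : ∀ a ∈ s, ∀ b ∈ s, a ≤ b → |g a - g b| ≤ K * (b - a)) : ContinuousOn g s := by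
  refine (LipschitzOnWith.of_dist_le_mul (K := K.toNNReal) fun a ha b hb => ?_).continuousOn
  rw [Real.dist_eq, Real.dist_eq, Real.coe_toNNReal K hK]
  rcases le_total a b with hab | hab
  · rw [abs_sub_comm a b, abs_of_nonneg (sub_nonneg.2 hab)]
    exact h a ha b hb hab
  · rw [abs_sub_comm, abs_of_nonneg (sub_nonneg.2 hab)]
    exact h b hb a ha hab

/-- A family bounded affinely by a parameter, and uniformly small for small parameters, is
bounded by a class `𝒦∞` function of the parameter. -/
theorem exists_classKinf_bound {ι : Type*} {p v : ι → ℝ} {c : ℝ} (hp : ∀ i, 0 ≤ p i)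
    (hc : 0 ≤ c) (hv : ∀ i, v i ≤ p i + c)
    (hsmall : ∀ ε : ℝ, 0 < ε → ∃ δ : ℝ, 0 < δ ∧ ∀ i, p i ≤ δ → v i ≤ ε) :
    ∃ H : ℝ → ℝ, ClassKinf H ∧ ∀ i, v i ≤ H (p i) := by
  let w : ℝ → ι → ℝ := fun s i => min 1 (s / p i) * max (v i) 0
  have hv' : ∀ i, max (v i) 0 ≤ p i + c := fun i => max_le (hv i) (add_nonneg (hp i) hc)
  have hvn : ∀ i, 0 ≤ max (v i) 0 := fun i => le_max_right _ _
  have hw0 : ∀ s, 0 ≤ s → ∀ i, 0 ≤ w s i := fun s hs i =>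
    mul_nonneg (le_min zero_le_one (div_nonneg hs (hp i))) (hvn i)
  have hwle : ∀ s, 0 ≤ s → ∀ i, w s i ≤ s + c := by
    intro s hs i
    rcases le_or_gt (p i) s with h | h
    · have : w s i ≤ 1 * max (v i) 0 := mul_le_mul_of_nonneg_right (min_le_left _ _) (hvn i)
      linarith [hv' i]
    · have hpos : 0 < p i := hs.trans_lt h
      have h1 : w s i ≤ s / p i * (p i + c) :=
        mul_le_mul (min_le_right _ _) (hv' i) (hvn i) (by positivity)
      have h2 : s / p i * (p i + c) = s + s / p i * c := by field_simp
      have h3 : s / p i * c ≤ 1 * c :=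
        mul_le_mul_of_nonneg_right ((div_le_one hpos).2 h.le) hc
      linarith
  have hbdd : ∀ s, 0 ≤ s → BddAbove (range (w s)) := fun s hs =>
    ⟨s + c, by rintro _ ⟨i, rfl⟩; exact hwle s hs i⟩
  have hwm : ∀ a b, a ≤ b → ∀ i, w a i ≤ w b i := fun a b hab i =>
    mul_le_mul_of_nonneg_right (min_le_min le_rfl (div_le_div_of_nonneg_right hab (hp i))) (hvn i)
  have hwl : ∀ r, 0 < r → ∀ a, r ≤ a → ∀ b, a ≤ b → ∀ i, w b i ≤ w a i + (1 + c / r) * (b - a) := by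
    intro r hr a ha b hab i
    have hcr : 0 ≤ c / r := by positivity
    have ha0 : 0 < a := hr.trans_le ha
    rcases (hp i).eq_or_lt with h0 | hpos
    · have : 0 ≤ (1 + c / r) * (b - a) := mul_nonneg (by linarith) (by linarith)
      simpa [w, ← h0] using this
    rcases le_or_gt (p i) a with h | h
    · have h1 : w a i = max (v i) 0 := by
        simp [w, min_eq_left ((one_le_div hpos).2 h)]
      have h2 : w b i ≤ 1 * max (v i) 0 := mul_le_mul_of_nonneg_right (min_le_left _ _) (hvn i)
      have : 0 ≤ (1 + c / r) * (b - a) := mul_nonneg (by linarith) (by linarith)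
      linarith
    · have h1 : w a i = a / p i * max (v i) 0 := by
        simp only [w]; rw [min_eq_right ((div_le_one hpos).2 h.le)]
      have h2 : w b i ≤ b / p i * max (v i) 0 :=
        mul_le_mul_of_nonneg_right (min_le_right _ _) (hvn i)
      have h3 : b / p i * max (v i) 0 - a / p i * max (v i) 0 = max (v i) 0 / p i * (b - a) := by
        field_simp
      have h4 : max (v i) 0 / p i ≤ 1 + c / r := by
        have : max (v i) 0 / p i ≤ (p i + c) / p i := div_le_div_of_nonneg_right (hv' i) hpos.le
        have h5 : (p i + c) / p i = 1 + c / p i := by field_simp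
        have h6 : c / p i ≤ c / r := div_le_div_of_nonneg_left hc hr (ha.trans h.le)
        linarith
      have := mul_le_mul_of_nonneg_right h4 (sub_nonneg.2 hab)
      linarith
  let B : ℝ → ℝ := fun s => ⨆ i, w s i
  have hBm : MonotoneOn B (Ici 0) := fun a ha b hb hab =>
    Real.iSup_le (fun i => (hwm a b hab i).trans (le_ciSup (hbdd b hb) i))
      (Real.iSup_nonneg (hw0 b hb))
  have hB0 : B 0 = 0 := by simp [B, w]
  have hBc : ContinuousOn B (Ici 0) := by
    intro s hs
    rcases (mem_Ici.1 hs).eq_or_lt with rfl | hpos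
    · rw [ContinuousWithinAt, hB0, Metric.tendsto_nhdsWithin_nhds]
      intro ε hε
      obtain ⟨δ, hδ, hδv⟩ := hsmall (ε / 2) (by positivity)
      refine ⟨ε / 2 / (1 + c / δ), by positivity, fun s hs hsd => ?_⟩
      have hs : 0 ≤ s := hs
      rw [Real.dist_eq, sub_zero, abs_of_nonneg hs] at hsd
      rw [Real.dist_eq, sub_zero, abs_of_nonneg (Real.iSup_nonneg (hw0 s hs))]
      refine lt_of_le_of_lt (Real.iSup_le (fun i => ?_) (by positivity)) (half_lt_self hε)
      rcases le_or_gt (p i) δ with h | h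
      · have h1 : w s i ≤ 1 * max (v i) 0 := mul_le_mul_of_nonneg_right (min_le_left _ _) (hvn i)
        have h2 : max (v i) 0 ≤ ε / 2 := max_le (hδv i h) (by positivity)
        linarith
      · have hpos : 0 < p i := hδ.trans h
        have h1 : w s i ≤ s / p i * (p i + c) :=
          mul_le_mul (min_le_right _ _) (hv' i) (hvn i) (by positivity)
        have h2 : s / p i * (p i + c) = s * (1 + c / p i) := by field_simp
        have h3 : s * (1 + c / p i) ≤ s * (1 + c / δ) :=
          mul_le_mul_of_nonneg_left (by linarith [div_le_div_of_nonneg_left hc hδ h.le]) hs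
        have h4 := (lt_div_iff₀ (by positivity)).1 hsd
        linarith
    · have hr : 0 < s / 2 := by positivity
      have hl : ContinuousOn B (Ici (s / 2)) := by
        refine continuousOn_of_abs_sub_le (K := 1 + c / (s / 2)) (by positivity)
          fun a ha b hb hab => ?_
        have ha0 : 0 ≤ a := hr.le.trans ha
        have hb0 : 0 ≤ b := hr.le.trans hb
        rw [abs_sub_comm, abs_of_nonneg (sub_nonneg.2 (hBm ha0 hb0 hab))]
        have := iSup_le_iSup_add (hbdd a ha0) (hw0 a ha0)
          (mul_nonneg (by positivity) (sub_nonneg.2 hab)) (hwl _ hr a ha b hab)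
        linarith
      exact (hl.continuousAt (Ici_mem_nhds (by linarith))).continuousWithinAt
  refine ⟨fun s => B s + s, ClassN.add_id ⟨hBc, hBm, hB0⟩, fun i => ?_⟩
  have hle := le_ciSup (hbdd _ (hp i)) i
  rcases (hp i).eq_or_lt with h0 | hpos
  · have hv0 : v i ≤ 0 := le_of_forall_pos_le_add fun ε hε => by
      obtain ⟨δ, hδ, h⟩ := hsmall ε hε
      simpa using h i (h0 ▸ hδ.le)
    simpa [← h0, hB0] using hv0
  · have h1 : w (p i) i = max (v i) 0 := by simp [w, div_self hpos.ne']
    have h2 : max (v i) 0 ≤ B (p i) := h1 ▸ hle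
    linarith [le_max_left (v i) 0]

theorem tendsto_mul_exp_neg (a b : ℝ) :
    Tendsto (fun t : ℝ => a * Real.exp (b - t)) atTop (𝓝 0) := by
  have h : Tendsto (fun t : ℝ => b - t) atTop atBot := by
    simpa [sub_eq_add_neg] using
      tendsto_atBot_add_const_left atTop b (tendsto_neg_atTop_atBot (G := ℝ))
  simpa using (Real.tendsto_exp_atBot.comp h).const_mul a

theorem min_one_exp_sub_le (c : ℝ) {s t : ℝ} (hst : s ≤ t) :
    min 1 (Real.exp (c - s)) ≤ min 1 (Real.exp (c - t)) + (t - s) := by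
  rcases le_total t c with h | h
  · rw [min_eq_left (Real.one_le_exp (sub_nonneg.2 h)),
      min_eq_left (Real.one_le_exp (by linarith))]
    linarith
  · rw [min_eq_right (a := (1 : ℝ)) (b := Real.exp (c - t)) (Real.exp_le_one_iff.2 (by linarith))]
    have h1 : Real.exp (c - t) = Real.exp (min 0 (c - s)) * Real.exp (c - t - min 0 (c - s)) := by
      rw [← Real.exp_add]; congr 1; ring
    have h2 : min 1 (Real.exp (c - s)) = Real.exp (min 0 (c - s)) := by
      rw [Real.exp_monotone.map_min, Real.exp_zero]
    have h3 := Real.add_one_le_exp (c - t - min 0 (c - s))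
    have h4 : Real.exp (min 0 (c - s)) ≤ 1 := Real.exp_le_one_iff.2 (min_le_left _ _)
    have h5 : c - t - min 0 (c - s) ≥ -(t - s) := by
      linarith [min_le_right 0 (c - s)]
    have h6 := Real.exp_pos (min 0 (c - s))
    have h7 : Real.exp (min 0 (c - s)) * (1 - (t - s)) ≤ Real.exp (c - t) := by
      rw [h1]
      exact mul_le_mul_of_nonneg_left (by linarith) h6.le
    have h8 := mul_le_mul_of_nonneg_right h4 (sub_nonneg.2 hst)
    rw [h2]
    linarith

/-- A family bounded by a class `𝒦∞` function of a size parameter, and uniformly small at late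
times on bounded sets of sizes, is bounded by a class `𝒦ℒ` function of size and time. -/
theorem exists_classKL_bound {ι : Type*} {p τ v : ι → ℝ} {h : ℝ → ℝ} (hh : ClassKinf h)
    (hp : ∀ i, 0 ≤ p i) (hv : ∀ i, v i ≤ h (p i))
    (hlate : ∀ r ε : ℝ, 0 < r → 0 < ε → ∃ T : ℝ, ∀ i, p i ≤ r → T ≤ τ i → v i ≤ ε) :
    ∃ β : ℝ → ℝ → ℝ, ClassKL β ∧ ∀ i, v i ≤ β (p i) (τ i) := by
  let V : ι → ℝ := fun i => max (v i) 0
  let k : ι → ℝ := fun i => h (p i)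
  have hk0 : ∀ i, 0 ≤ k i := fun i => hh.1.nonneg (hp i)
  have hV0 : ∀ i, 0 ≤ V i := fun i => le_max_right _ _
  have hVk : ∀ i, V i ≤ k i := fun i => max_le (hv i) (hk0 i)
  let A : ℝ → ι → ℝ := fun q i => min 1 ((q / k i) ^ 2) * V i
  let e : ℝ → ι → ℝ := fun t i => min 1 (Real.exp (τ i - t))
  have he0 : ∀ t i, 0 ≤ e t i := fun t i => le_min zero_le_one (Real.exp_pos _).le
  have he1 : ∀ t i, e t i ≤ 1 := fun t i => min_le_left _ _
  have hA0 : ∀ q i, 0 ≤ A q i := fun q i =>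
    mul_nonneg (le_min zero_le_one (sq_nonneg _)) (hV0 i)
  have hAV : ∀ q i, A q i ≤ V i := fun q i =>
    (mul_le_mul_of_nonneg_right (min_le_left _ _) (hV0 i)).trans (one_mul _).le
  have hAsq : ∀ q i, A q i * k i ≤ q ^ 2 := by
    intro q i
    rcases (hk0 i).eq_or_lt with h0 | hpos
    · rw [← h0, mul_zero]; positivity
    · have h1 : A q i ≤ (q / k i) ^ 2 * k i :=
        mul_le_mul (min_le_right _ _) (hVk i) (hV0 i) (sq_nonneg _)
      calc A q i * k i ≤ (q / k i) ^ 2 * k i * k i := mul_le_mul_of_nonneg_right h1 hpos.le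
        _ = q ^ 2 := by field_simp
  have hAq : ∀ q, 0 ≤ q → ∀ i, A q i ≤ q := by
    intro q hq i
    by_contra! hlt
    have h1 : q < k i := hlt.trans_le ((hAV q i).trans (hVk i))
    have := hAsq q i
    nlinarith
  have hAm : ∀ a b, 0 ≤ a → a ≤ b → ∀ i, A a i ≤ A b i := fun a b ha hab i =>
    mul_le_mul_of_nonneg_right (min_le_min le_rfl
      (pow_le_pow_left₀ (div_nonneg ha (hk0 i)) (div_le_div_of_nonneg_right hab (hk0 i)) 2)) (hV0 i)
  have hAl : ∀ a b, 0 ≤ a → a ≤ b → ∀ i, A b i ≤ A a i + 2 * (b - a) := by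
    intro a b ha hab i
    rcases (hk0 i).eq_or_lt with h0 | hpos
    · have h1 : A b i ≤ 0 := (hAV b i).trans ((hVk i).trans h0.symm.le)
      linarith [hA0 a i]
    rcases le_or_gt (k i) a with h | h
    · have h1 : A a i = V i := by
        simp only [A]
        rw [min_eq_left (one_le_pow₀ ((one_le_div hpos).2 h)), one_mul]
      linarith [hAV b i]
    · have h1 : A a i = (a / k i) ^ 2 * V i := by
        simp only [A]
        rw [min_eq_right (pow_le_one₀ (by positivity) ((div_le_one hpos).2 h.le))]
      have h2 : min 1 ((b / k i) ^ 2) - (a / k i) ^ 2 ≤ 2 * (b - a) / k i := by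
        have hx : (a / k i) < 1 := (div_lt_one hpos).2 h
        have hx0 : 0 ≤ a / k i := by positivity
        have hxy : 2 * (b - a) / k i = 2 * (b / k i - a / k i) := by ring
        have hab' : a / k i ≤ b / k i := div_le_div_of_nonneg_right hab hpos.le
        rw [hxy]
        rcases le_total (b / k i) 1 with h3 | h3
        · have := min_le_right 1 ((b / k i) ^ 2)
          nlinarith
        · have := min_le_left 1 ((b / k i) ^ 2)
          nlinarith
      have h3 : 0 ≤ 2 * (b - a) / k i := div_nonneg (by linarith) hpos.le
      have h4 : A b i - A a i = (min 1 ((b / k i) ^ 2) - (a / k i) ^ 2) * V i := by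
        rw [h1]; simp only [A]; ring
      have h5 : 2 * (b - a) / k i * V i ≤ 2 * (b - a) / k i * k i :=
        mul_le_mul_of_nonneg_left (hVk i) h3
      have h6 : 2 * (b - a) / k i * k i = 2 * (b - a) := by field_simp
      have h7 := mul_le_mul_of_nonneg_right h2 (hV0 i)
      linarith
  let w : ℝ → ℝ → ι → ℝ := fun q t i => A q i * e t i
  have hw0 : ∀ q t i, 0 ≤ w q t i := fun q t i => mul_nonneg (hA0 q i) (he0 t i)
  have hwA : ∀ q t i, w q t i ≤ A q i := fun q t i =>
    mul_le_of_le_one_right (hA0 q i) (he1 t i)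
  have hwq : ∀ q, 0 ≤ q → ∀ t i, w q t i ≤ q := fun q hq t i => (hwA q t i).trans (hAq q hq i)
  have hbdd : ∀ q, 0 ≤ q → ∀ t, BddAbove (range (w q t)) := fun q hq t =>
    ⟨q, by rintro _ ⟨i, rfl⟩; exact hwq q hq t i⟩
  let B : ℝ → ℝ → ℝ := fun q t => ⨆ i, w q t i
  have hB0 : ∀ q t, 0 ≤ B q t := fun q t => Real.iSup_nonneg (hw0 q t)
  have hBm : ∀ t, MonotoneOn (fun q => B q t) (Ici 0) := fun t a ha b hb hab =>
    Real.iSup_le (fun i => (mul_le_mul_of_nonneg_right (hAm a b ha hab i) (he0 t i)).trans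
      (le_ciSup (hbdd b hb t) i)) (hB0 b t)
  have hBc : ∀ t, ContinuousOn (fun q => B q t) (Ici 0) := by
    refine fun t => continuousOn_of_abs_sub_le (K := 2) (by norm_num) fun a ha b hb hab => ?_
    rw [abs_sub_comm, abs_of_nonneg (sub_nonneg.2 (hBm t ha hb hab))]
    have := iSup_le_iSup_add (g := w b t) (hbdd a ha t) (hw0 a t)
      (mul_nonneg (by norm_num : (0 : ℝ) ≤ 2) (sub_nonneg.2 hab)) (fun i => by
        have h1 := mul_le_mul_of_nonneg_right (hAl a b ha hab i) (he0 t i)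
        have h2 : 2 * (b - a) * e t i ≤ 2 * (b - a) * 1 :=
          mul_le_mul_of_nonneg_left (he1 t i) (by linarith)
        simp only [w]
        linarith)
    simp only [B]
    linarith
  have hBa : ∀ q, 0 ≤ q → ∀ s t, s ≤ t → B q t ≤ B q s := fun q hq s t hst =>
    Real.iSup_le (fun i => (mul_le_mul_of_nonneg_left
      (min_le_min le_rfl (Real.exp_le_exp.2 (by linarith))) (hA0 q i)).trans
      (le_ciSup (hbdd q hq s) i)) (hB0 q s)
  have hBt : ∀ q, 0 ≤ q → Continuous (B q) := by
    intro q hq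
    rw [← continuousOn_univ]
    refine continuousOn_of_abs_sub_le (K := q) hq fun s _ t _ hst => ?_
    rw [abs_of_nonneg (sub_nonneg.2 (hBa q hq s t hst))]
    have := iSup_le_iSup_add (g := w q s) (hbdd q hq t) (hw0 q t)
      (mul_nonneg hq (sub_nonneg.2 hst)) (fun i => by
        have h1 := mul_le_mul_of_nonneg_left (min_one_exp_sub_le (τ i) hst) (hA0 q i)
        have h2 := mul_le_mul_of_nonneg_right (hAq q hq i) (sub_nonneg.2 hst)
        simp only [w, e]
        linarith)
    simp only [B]
    linarith
  have hBlim : ∀ q, 0 ≤ q → Tendsto (B q) atTop (𝓝 0) := by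
    intro q hq
    rw [Metric.tendsto_nhds]
    intro ε hε
    obtain ⟨r, hr, hr0⟩ := ((hh.2.eventually_ge_atTop (q ^ 2 / (ε / 2))).and
      (eventually_gt_atTop 0)).exists
    obtain ⟨T, hT⟩ := hlate r (ε / 2) hr0 (by positivity)
    filter_upwards [(tendsto_mul_exp_neg q T).eventually_le_const (half_pos hε)] with t ht
    rw [Real.dist_eq, sub_zero, abs_of_nonneg (hB0 q t)]
    refine lt_of_le_of_lt (Real.iSup_le (fun i => ?_) (by positivity)) (half_lt_self hε)
    rcases le_total (p i) r with h1 | h1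
    · rcases le_total T (τ i) with h2 | h2
      · exact (hwA q t i).trans ((hAV q i).trans (max_le (hT i h1 h2) (by positivity)))
      · refine le_trans (mul_le_mul (hAq q hq i) ((min_le_right _ _).trans
          (Real.exp_le_exp.2 (by linarith))) (he0 t i) hq) ht
    · have hk : q ^ 2 / (ε / 2) ≤ k i := hr.trans (hh.1.mono hr0.le h1)
      refine (hwA q t i).trans ?_
      have h2 := hAsq q i
      by_contra! h3
      have h4 : 0 ≤ q ^ 2 / (ε / 2) := by positivity
      have h5 : q ^ 2 / (ε / 2) * (ε / 2) = q ^ 2 := by field_simp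
      rcases hq.eq_or_lt with rfl | hq'
      · linarith [hAq 0 le_rfl i]
      · have : 0 < q ^ 2 / (ε / 2) := by positivity
        nlinarith
  refine ⟨fun s t => B (h s) t + s * Real.exp (0 - t), ⟨fun t _ => ?_, fun s hs => ?_⟩,
    fun i => ?_⟩
  · have hn : MapsTo h (Ici 0) (Ici 0) := fun s hs => hh.1.nonneg hs
    refine ⟨((hBc t).comp hh.1.1 hn).add (by fun_prop), fun a ha b hb hab => ?_, ?_⟩
    · exact add_lt_add_of_le_of_lt (hBm t (hn ha) (hn hb) (hh.1.mono ha hab.le))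
        (mul_lt_mul_of_pos_right hab (Real.exp_pos _))
    · have : B 0 t ≤ 0 := Real.iSup_le (hwq 0 le_rfl t) le_rfl
      simp [hh.1.2.2, le_antisymm this (hB0 0 t)]
  · have hs' := hh.1.nonneg hs
    refine ⟨((hBt _ hs').add (by fun_prop)).continuousOn, fun a _ b _ hab => ?_, ?_⟩
    · exact add_le_add (hBa _ hs' a b hab)
        (mul_le_mul_of_nonneg_left (Real.exp_le_exp.2 (by linarith)) hs)
    · simpa using (hBlim _ hs').add (tendsto_mul_exp_neg s 0)
  · have h1 := le_ciSup (hbdd _ (hk0 i) (τ i)) i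
    have h2 : 0 ≤ p i * Real.exp (0 - τ i) := mul_nonneg (hp i) (Real.exp_pos _).le
    have h3 : V i ≤ w (k i) (τ i) i := by
      rcases (hk0 i).eq_or_lt with h0 | hpos
      · exact ((hVk i).trans h0.symm.le).trans (hw0 _ _ _)
      · simp [w, A, e, div_self hpos.ne']
    have h4 : v i ≤ V i := le_max_left _ _
    exact h4.trans (h3.trans (h1.trans (le_add_of_nonneg_right h2)))

section Inputs

variable {m : ℕ} {u : ℝ → Vec m}

theorem isInput_zero : IsInput (fun _ : ℝ => (0 : Vec m)) :=
  ⟨measurable_const, fun _ _ => ⟨0, by simp⟩⟩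

theorem IsInput.shift (hu : IsInput u) {a : ℝ} (ha : 0 ≤ a) : IsInput fun s => u (s + a) := by
  refine ⟨hu.1.comp (measurable_add_const a), fun T hT => ?_⟩
  obtain ⟨C, hC⟩ := hu.2 (T + a) (by linarith)
  refine ⟨C, ?_⟩
  filter_upwards [(measurePreserving_add_right volume a).quasiMeasurePreserving.ae hC] with t ht h
  exact ht ⟨by linarith [h.1], by linarith [h.2]⟩

theorem IsInput.intervalIntegrable (hu : IsInput u) {μ : ℝ → ℝ} (hμ : ClassN μ) {a b : ℝ}
    (ha : 0 ≤ a) (hb : 0 ≤ b) : IntervalIntegrable (fun s => μ ‖u s‖) volume a b := by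
  have hmeas : Measurable fun s => μ ‖u s‖ := by
    have h1 : Continuous fun s => μ (max s 0) :=
      hμ.1.comp_continuous (by fun_prop) fun s => le_max_right s 0
    have h2 : (fun s => μ ‖u s‖) = fun s => μ (max ‖u s‖ 0) := by
      funext s; rw [max_eq_left (norm_nonneg _)]
    rw [h2]
    exact h1.measurable.comp hu.1.norm
  have key : ∀ T, 0 ≤ T → IntervalIntegrable (fun s => μ ‖u s‖) volume 0 T := by
    intro T hT
    rcases hT.eq_or_lt with rfl | hT'
    · exact IntervalIntegrable.refl
    obtain ⟨C, hC⟩ := hu.2 T hT'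
    rw [intervalIntegrable_iff_integrableOn_Icc_of_le hT]
    refine Measure.integrableOn_of_bounded (M := μ C) (by simp) hmeas.aestronglyMeasurable ?_
    rw [ae_restrict_iff' measurableSet_Icc]
    filter_upwards [hC] with s hs hsT
    rw [Real.norm_eq_abs, abs_of_nonneg (hμ.nonneg (norm_nonneg _))]
    exact hμ.2.1 (norm_nonneg _) ((norm_nonneg _).trans (hs hsT)) (hs hsT)
  exact (key a ha).symm.trans (key b hb)

/-- The energy `∫₀ᵗ χ(|u(s)|) ds` of an input. -/
noncomputable def energy (χ : ℝ → ℝ) (u : ℝ → Vec m) (t : ℝ) : ℝ := ∫ s in (0 : ℝ)..t, χ ‖u s‖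

theorem energy_nonneg {χ : ℝ → ℝ} (hχ : ClassN χ) {t : ℝ} (ht : 0 ≤ t) : 0 ≤ energy χ u t :=
  intervalIntegral.integral_nonneg ht fun _ _ => hχ.nonneg (norm_nonneg _)

theorem IsInput.energy_add (hu : IsInput u) {χ : ℝ → ℝ} (hχ : ClassN χ) {a t : ℝ} (ha : 0 ≤ a)
    (ht : 0 ≤ t) : energy χ u a + energy χ (fun s => u (s + a)) t = energy χ u (t + a) := by
  have h := intervalIntegral.integral_comp_add_right (a := 0) (b := t) (fun s => χ ‖u s‖) a
  rw [energy, energy, energy, h, zero_add]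
  exact intervalIntegral.integral_add_adjacent_intervals (hu.intervalIntegrable hχ le_rfl ha)
    (hu.intervalIntegrable hχ ha (by linarith))

theorem IsInput.energy_mono (hu : IsInput u) {χ : ℝ → ℝ} (hχ : ClassN χ) {s t : ℝ} (hs : 0 ≤ s)
    (hst : s ≤ t) : energy χ u s ≤ energy χ u t := by
  have := hu.energy_add hχ hs (sub_nonneg.2 hst)
  rw [sub_add_cancel] at this
  linarith [energy_nonneg (u := fun r => u (r + s)) hχ (sub_nonneg.2 hst)]

theorem IsInput.energy_le_energy (hu : IsInput u) {χ ψ : ℝ → ℝ} (hχ : ClassN χ) (hψ : ClassN ψ)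
    (h : ∀ s, 0 ≤ s → χ s ≤ ψ s) {t : ℝ} (ht : 0 ≤ t) : energy χ u t ≤ energy ψ u t :=
  intervalIntegral.integral_mono_on ht (hu.intervalIntegrable hχ le_rfl ht)
    (hu.intervalIntegrable hψ le_rfl ht) fun _ _ => h _ (norm_nonneg _)

theorem energy_zero {χ : ℝ → ℝ} (hχ : ClassN χ) (t : ℝ) :
    energy χ (fun _ => (0 : Vec m)) t = 0 := by
  simp [energy, hχ.2.2]

end Inputs

section Segments

variable {Δ : ℝ≥0} {n : ℕ} {x y : ℝ → Vec n}

theorem seg_apply {t : ℝ} (hx : ContinuousOn x (Icc (t - (Δ : ℝ)) t))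
    (τ : Icc (-(Δ : ℝ)) (0 : ℝ)) : seg Δ x t τ = x (t + τ.1) := by
  rw [seg, dif_pos hx]; rfl

theorem seg_congr {t : ℝ} (hx : ContinuousOn x (Icc (t - (Δ : ℝ)) t))
    (h : ∀ s ∈ Icc (t - (Δ : ℝ)) t, y s = x s) : seg Δ y t = seg Δ x t := by
  ext1 τ
  rw [seg_apply hx, seg_apply (hx.congr h)]
  exact h _ ⟨by linarith [τ.2.1], by linarith [τ.2.2]⟩

theorem continuous_seg (hx : Continuous x) : Continuous (seg Δ x) := by
  let F : C(ℝ × Icc (-(Δ : ℝ)) (0 : ℝ), Vec n) := ⟨fun p => x (p.1 + p.2.1), by fun_prop⟩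
  have : seg Δ x = F.curry := by
    funext t
    ext1 τ
    rw [seg_apply hx.continuousOn]; rfl
  rw [this]
  exact F.curry.continuous

theorem continuousOn_seg {T : ℝ} (hx : ContinuousOn x (Icc (-(Δ : ℝ)) T)) :
    ContinuousOn (seg Δ x) (Icc 0 T) := by
  rcases lt_or_ge T 0 with hT | hT
  · simp [Icc_eq_empty_of_lt hT]
  have hΔT : -(Δ : ℝ) ≤ T := by linarith [Δ.coe_nonneg]
  have hc : Continuous fun s => x (projIcc (-(Δ : ℝ)) T hΔT s) :=
    hx.comp_continuous (continuous_subtype_val.comp continuous_projIcc) fun s => Subtype.prop _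
  refine (continuous_seg (Δ := Δ) hc).continuousOn.congr fun t ht => ?_
  refine seg_congr hc.continuousOn fun s hs => ?_
  rw [projIcc_of_mem hΔT ⟨by linarith [ht.1, hs.1], by linarith [ht.2, hs.2]⟩]

theorem seg_sub_norm_le {t b : ℝ} (hb : 0 ≤ b) (hx : ContinuousOn x (Icc (t - (Δ : ℝ)) t))
    (hy : ContinuousOn y (Icc (t - (Δ : ℝ)) t))
    (h : ∀ s ∈ Icc (t - (Δ : ℝ)) t, ‖x s - y s‖ ≤ b) : ‖seg Δ x t - seg Δ y t‖ ≤ b := by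
  refine (ContinuousMap.norm_le _ hb).2 fun τ => ?_
  rw [ContinuousMap.sub_apply, seg_apply hx, seg_apply hy]
  exact h _ ⟨by linarith [τ.2.1], by linarith [τ.2.2]⟩

theorem seg_norm_le {t b : ℝ} (hb : 0 ≤ b) (hx : ContinuousOn x (Icc (t - (Δ : ℝ)) t))
    (h : ∀ s ∈ Icc (t - (Δ : ℝ)) t, ‖x s‖ ≤ b) : ‖seg Δ x t‖ ≤ b := by
  refine (ContinuousMap.norm_le _ hb).2 fun τ => ?_
  rw [seg_apply hx]
  exact h _ ⟨by linarith [τ.2.1], by linarith [τ.2.2]⟩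

end Segments

section Solutions

variable {Δ : ℝ≥0} {n m : ℕ} {f : Hist Δ n → Vec m → Vec n} {u : ℝ → Vec m} {x₀ : Hist Δ n}
  {tmax : EReal} {x y : ℝ → Vec n}

theorem IsSolution.continuousOn_Icc (h : IsSolution Δ f u x₀ tmax x) {a t : ℝ}
    (ha : -(Δ : ℝ) ≤ a) (ht : (t : EReal) < tmax) : ContinuousOn x (Icc a t) :=
  h.cont.mono fun _ hs => ⟨ha.trans hs.1, (EReal.coe_le_coe_iff.2 hs.2).trans_lt ht⟩

theorem IsSolution.congr (h : IsSolution Δ f u x₀ tmax x)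
    (hy : ∀ t : ℝ, -(Δ : ℝ) ≤ t → (t : EReal) < tmax → y t = x t) :
    IsSolution Δ f u x₀ tmax y := by
  have hΔ := Δ.coe_nonneg
  have hseg : ∀ t : ℝ, 0 ≤ t → (t : EReal) < tmax →
      ∀ s ∈ uIcc 0 t, f (seg Δ x s) (u s) = f (seg Δ y s) (u s) := by
    intro t ht htm s hs
    rw [uIcc_of_le ht] at hs
    have hst := (EReal.coe_le_coe_iff.2 hs.2).trans_lt htm
    rw [seg_congr (h.continuousOn_Icc (by linarith [hs.1]) hst) fun r hr =>
      hy r (by linarith [hr.1, hs.1]) ((EReal.coe_le_coe_iff.2 hr.2).trans_lt hst)]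
  have h0 : y 0 = x 0 := hy 0 (by linarith) h.tmax_pos
  refine ⟨h.tmax_pos, h.cont.congr fun t ht => hy t ht.1 ht.2, fun τ => ?_, fun t ht htm => ?_,
    fun t ht htm => ?_⟩
  · rw [hy τ.1 τ.2.1 ((EReal.coe_le_coe_iff.2 τ.2.2).trans_lt h.tmax_pos), h.init]
  · exact (h.integrable t ht htm).congr fun s hs => hseg t ht htm s (uIoc_subset_uIcc hs)
  · rw [hy t (by linarith) htm, h0, h.integral_eq t ht htm,
      intervalIntegral.integral_congr (hseg t ht htm)]

theorem IsSolution.of_forall_lt (h0 : 0 < tmax)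
    (h : ∀ t : ℝ, (t : EReal) < tmax → ∃ T : EReal, (t : EReal) < T ∧ T ≤ tmax ∧
      IsSolution Δ f u x₀ T x) :
    IsSolution Δ f u x₀ tmax x := by
  refine ⟨h0, fun t ht => ?_, fun τ => ?_, fun t ht htm => ?_, fun t ht htm => ?_⟩
  · obtain ⟨T, htT, -, hT⟩ := h t ht.2
    have ho : {s : ℝ | (s : EReal) < T} ∈ 𝓝 t :=
      (isOpen_Iio.preimage continuous_coe_real_ereal).mem_nhds htT
    refine (hT.cont t ⟨ht.1, htT⟩).mono_of_mem_nhdsWithin ?_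
    filter_upwards [self_mem_nhdsWithin, mem_nhdsWithin_of_mem_nhds ho] with s hs hs'
    exact ⟨hs.1, hs'⟩
  · obtain ⟨T, -, -, hT⟩ := h 0 h0
    exact hT.init τ
  · obtain ⟨T, htT, -, hT⟩ := h t htm
    exact hT.integrable t ht htT
  · obtain ⟨T, htT, -, hT⟩ := h t htm
    exact hT.integral_eq t ht htT

theorem IsSolution.isMaxSolution (h : IsSolution Δ f u x₀ ⊤ x) : IsMaxSolution Δ f u x₀ ⊤ x :=
  ⟨h, fun _ _ _ _ => le_top⟩

/-- Every solution extends to a maximal one. -/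
theorem exists_isMaxSolution (h : IsSolution Δ f u x₀ tmax x) :
    ∃ (T : EReal) (y : ℝ → Vec n), IsMaxSolution Δ f u x₀ T y := by
  let S := {p : EReal × (ℝ → Vec n) // IsSolution Δ f u x₀ p.1 p.2}
  let r : S → S → Prop := fun a b => a.1.1 ≤ b.1.1 ∧
    ∀ t : ℝ, -(Δ : ℝ) ≤ t → (t : EReal) < a.1.1 → b.1.2 t = a.1.2 t
  have htrans : ∀ {a b c : S}, r a b → r b c → r a c := fun hab hbc =>
    ⟨hab.1.trans hbc.1, fun t ht hta =>
      (hbc.2 t ht (hta.trans_le hab.1)).trans (hab.2 t ht hta)⟩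
  have hchain : ∀ c : Set S, IsChain r c → ∃ ub, ∀ a ∈ c, r a ub := by
    intro c hc
    rcases c.eq_empty_or_nonempty with rfl | ⟨a₀, ha₀⟩
    · exact ⟨⟨(tmax, x), h⟩, by simp⟩
    classical
    let T : EReal := ⨆ a : c, a.1.1.1
    let y : ℝ → Vec n := fun t => if ht : ∃ a : c, (t : EReal) < a.1.1.1
      then (Classical.choose ht).1.1.2 t else 0
    have hleT : ∀ a ∈ c, a.1.1 ≤ T := fun a ha => le_iSup (fun a : c => a.1.1.1) ⟨a, ha⟩
    have hya : ∀ a ∈ c, ∀ t : ℝ, -(Δ : ℝ) ≤ t → (t : EReal) < a.1.1 → y t = a.1.2 t := by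
      intro a ha t ht hta
      have hex : ∃ a : c, (t : EReal) < a.1.1.1 := ⟨⟨a, ha⟩, hta⟩
      have hy : y t = (Classical.choose hex).1.1.2 t := dif_pos hex
      have hb := Classical.choose_spec hex
      generalize Classical.choose hex = b at hy hb
      rw [hy]
      by_cases hab : a = b.1
      · rw [hab]
      · rcases hc ha b.2 hab with h1 | h1
        · exact h1.2 t ht hta
        · exact (h1.2 t ht hb).symm
    refine ⟨⟨(T, y), ?_⟩, fun a ha => ⟨hleT a ha, hya a ha⟩⟩
    refine IsSolution.of_forall_lt (a₀.2.tmax_pos.trans_le (hleT a₀ ha₀)) fun t ht => ?_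
    obtain ⟨a, hta⟩ := lt_iSup_iff.1 ht
    exact ⟨a.1.1.1, hta, hleT a.1 a.2, a.1.2.congr (hya a.1 a.2)⟩
  obtain ⟨M, hM⟩ := exists_maximal_of_chains_bounded hchain htrans
  refine ⟨M.1.1, M.1.2, M.2, fun T y hy hag => ?_⟩
  rcases le_total T M.1.1 with hT | hT
  · exact hT
  · exact (hM ⟨(T, y), hy⟩ ⟨hT, hag⟩).1

theorem IsSolution.shift (h : IsSolution Δ f u x₀ ⊤ x) {a : ℝ} (ha : 0 ≤ a) :
    IsSolution Δ f (fun s => u (s + a)) (seg Δ x a) ⊤ fun s => x (s + a) := by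
  have hΔ := Δ.coe_nonneg
  have hcI : ∀ t : ℝ, 0 ≤ t → ContinuousOn x (Icc (t - (Δ : ℝ)) t) := fun t ht =>
    h.continuousOn_Icc (by linarith) (EReal.coe_lt_top t)
  have hseg : ∀ s : ℝ, 0 ≤ s → seg Δ (fun r => x (r + a)) s = seg Δ x (s + a) := by
    intro s hs
    have hc : ContinuousOn (fun r => x (r + a)) (Icc (s - (Δ : ℝ)) s) :=
      (hcI (s + a) (by linarith)).comp (by fun_prop) fun r hr =>
        ⟨by linarith [hr.1], by linarith [hr.2]⟩
    ext1 τ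
    rw [seg_apply hc, seg_apply (hcI _ (by linarith))]
    congr 1; ring
  have hint : ∀ t : ℝ, 0 ≤ t → IntervalIntegrable (fun s => f (seg Δ x s) (u s)) volume 0 t :=
    fun t ht => h.integrable t ht (EReal.coe_lt_top t)
  refine ⟨EReal.zero_lt_top, ?_, fun τ => ?_, fun t ht _ => ?_, fun t ht _ => ?_⟩
  · exact h.cont.comp (by fun_prop) fun r hr => ⟨by linarith [hr.1], EReal.coe_lt_top _⟩
  · rw [seg_apply (hcI a ha), add_comm]
  · have h1 := ((hint a ha).symm.trans (hint (t + a) (by linarith))).comp_add_right a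
    rw [sub_self, add_sub_cancel_right] at h1
    refine h1.congr fun s hs => ?_
    rw [uIoc_of_le ht] at hs
    simp only [hseg s hs.1.le]
  · have h1 := intervalIntegral.integral_comp_add_right (a := 0) (b := t)
      (fun s => f (seg Δ x s) (u s)) a
    have h2 : ∫ s in (0 : ℝ)..t, f (seg Δ (fun r => x (r + a)) s) (u (s + a)) =
        ∫ s in (0 : ℝ)..t, f (seg Δ x (s + a)) (u (s + a)) :=
      intervalIntegral.integral_congr fun s hs => by
        rw [uIcc_of_le ht] at hs
        simp only [hseg s hs.1]
    rw [h2, h1, zero_add, h.integral_eq (t + a) (by linarith) (EReal.coe_lt_top _),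
      h.integral_eq a ha (EReal.coe_lt_top _), add_assoc,
      intervalIntegral.integral_add_adjacent_intervals (hint a ha)
        ((hint a ha).symm.trans (hint (t + a) (by linarith)))]

end Solutions

section VectorField

variable {Δ : ℝ≥0} {n m : ℕ} {f : Hist Δ n → Vec m → Vec n}

theorem LipOnBounded.continuous_zero_input (hf : LipOnBounded f) : Continuous fun φ => f φ 0 := by
  refine continuous_iff_continuousAt.2 fun φ => ?_
  obtain ⟨L, hL, h⟩ := hf (‖φ‖ + 1) (by positivity)
  have hl : LipschitzOnWith L.toNNReal (fun φ => f φ 0) (Metric.closedBall 0 (‖φ‖ + 1)) := by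
    refine LipschitzOnWith.of_dist_le_mul fun a ha b hb => ?_
    rw [mem_closedBall_zero_iff] at ha hb
    rw [dist_eq_norm, dist_eq_norm, Real.coe_toNNReal L hL.le]
    simpa using h a b 0 0 ha hb (by simp; positivity) (by simp; positivity)
  refine hl.continuousOn.continuousAt (Filter.mem_of_superset
    (Metric.closedBall_mem_nhds φ one_pos) fun ψ hψ => ?_)
  rw [mem_closedBall_zero_iff]
  rw [mem_closedBall_iff_norm] at hψ
  linarith [norm_le_norm_add_norm_sub' ψ φ]

/-- Local existence for the input-free system, by Picard iteration. -/
theorem LipOnBounded.exists_isSolution_zero_input (hf : LipOnBounded f) (x₀ : Hist Δ n) :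
    ∃ (T : EReal) (x : ℝ → Vec n), IsSolution Δ f (fun _ => 0) x₀ T x := by
  have hΔ := Δ.coe_nonneg
  have hΔ0 : -(Δ : ℝ) ≤ 0 := by linarith
  let M : ℝ := ‖x₀‖ + 1
  have hM : 0 < M := by positivity
  obtain ⟨L, hL, hlip⟩ := hf M hM
  let g : Hist Δ n → Vec n := fun φ => f φ 0
  have hgc : Continuous g := hf.continuous_zero_input
  have hgl : ∀ φ ψ : Hist Δ n, ‖φ‖ ≤ M → ‖ψ‖ ≤ M → ‖g φ - g ψ‖ ≤ L * ‖φ - ψ‖ := by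
    intro φ ψ h1 h2
    simpa using hlip φ ψ 0 0 h1 h2 (by simpa using hM.le) (by simpa using hM.le)
  let G : ℝ := ‖g 0‖ + L * M
  have hG : 0 ≤ G := by positivity
  have hgb : ∀ φ : Hist Δ n, ‖φ‖ ≤ M → ‖g φ‖ ≤ G := by
    intro φ hφ
    have h1 := hgl φ 0 hφ (by simpa using hM.le)
    rw [sub_zero] at h1
    have h2 : L * ‖φ‖ ≤ L * M := mul_le_mul_of_nonneg_left hφ hL.le
    have h3 := norm_le_norm_add_norm_sub' (g φ) (g 0)
    simp only [G]
    linarith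
  let h : ℝ := 1 / (2 * (L + G + 1))
  have hh : 0 < h := by positivity
  have hhs : h * (L + G + 1) = 1 / 2 := by simp only [h]; field_simp
  have hhL : h * L ≤ 1 / 2 := by nlinarith
  have hhG : h * G ≤ 1 := by nlinarith
  have hΔh : -(Δ : ℝ) ≤ h := by linarith
  let X₀ : ℝ → Vec n := fun s => x₀ (projIcc (-(Δ : ℝ)) 0 hΔ0 s)
  have hX₀ : Continuous X₀ := x₀.continuous.comp continuous_projIcc
  let ext : C(Icc (-(Δ : ℝ)) h, Vec n) → ℝ → Vec n := fun y s => y (projIcc (-(Δ : ℝ)) h hΔh s)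
  have hext : ∀ y, Continuous (ext y) := fun y => y.continuous.comp continuous_projIcc
  have hgs : ∀ y, Continuous fun s => g (seg Δ (ext y) s) := fun y =>
    hgc.comp (continuous_seg (hext y))
  let Φ : C(Icc (-(Δ : ℝ)) h, Vec n) → C(Icc (-(Δ : ℝ)) h, Vec n) := fun y =>
    ⟨fun t => X₀ t + ∫ s in (0 : ℝ)..(max t.1 0), g (seg Δ (ext y) s), by
      have h1 := intervalIntegral.continuous_primitive (μ := volume)
        (fun a b => (hgs y).intervalIntegrable a b) 0
      exact (hX₀.comp continuous_subtype_val).add (h1.comp (by fun_prop))⟩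
  let S : Set C(Icc (-(Δ : ℝ)) h, Vec n) := {y | ∀ t, ‖y t - X₀ t‖ ≤ 1}
  have hS : IsClosed S := by
    simp only [S, ofPred_forall]
    exact isClosed_iInter fun t => isClosed_le (by fun_prop) continuous_const
  have hSM : ∀ y ∈ S, ∀ s, ‖seg Δ (ext y) s‖ ≤ M := by
    intro y hy s
    refine seg_norm_le hM.le (hext y).continuousOn fun r _ => ?_
    have h1 := hy (projIcc (-(Δ : ℝ)) h hΔh r)
    have h2 := norm_le_norm_add_norm_sub' (ext y r) (X₀ (projIcc (-(Δ : ℝ)) h hΔh r))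
    have h3 : ‖X₀ (projIcc (-(Δ : ℝ)) h hΔh r)‖ ≤ ‖x₀‖ := x₀.norm_coe_le_norm _
    simp only [M]
    exact h2.trans (add_le_add h3 h1)
  have hmaxh : ∀ t : Icc (-(Δ : ℝ)) h, |max t.1 0 - 0| ≤ h := fun t => by
    rw [sub_zero, abs_of_nonneg (le_max_right _ _)]
    exact max_le t.2.2 hh.le
  have hmaps : MapsTo Φ S S := by
    intro y hy t
    have h1 : Φ y t - X₀ t = ∫ s in (0 : ℝ)..(max t.1 0), g (seg Δ (ext y) s) :=
      add_sub_cancel_left _ _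
    rw [h1]
    refine (intervalIntegral.norm_integral_le_of_norm_le_const
      fun s _ => hgb _ (hSM y hy s)).trans ?_
    rw [mul_comm]
    exact (mul_le_mul_of_nonneg_right (hmaxh t) hG).trans hhG
  have hcontr : ContractingWith (1 / 2) (hmaps.restrict Φ S S) := by
    refine ⟨by rw [← NNReal.coe_lt_coe]; norm_num, LipschitzWith.of_dist_le_mul fun a b => ?_⟩
    rw [Subtype.dist_eq, Subtype.dist_eq]
    refine (ContinuousMap.dist_le (by positivity)).2 fun t => ?_
    have h1 : Φ a t - Φ b t =
        ∫ s in (0 : ℝ)..(max t.1 0), (g (seg Δ (ext a) s) - g (seg Δ (ext b) s)) := by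
      rw [intervalIntegral.integral_sub ((hgs _).intervalIntegrable _ _)
        ((hgs _).intervalIntegrable _ _)]
      exact add_sub_add_left_eq_sub _ _ _
    change dist (Φ a t) (Φ b t) ≤ _
    rw [dist_eq_norm, h1]
    refine (intervalIntegral.norm_integral_le_of_norm_le_const (C := L * dist a.1 b.1)
      fun s _ => ?_).trans ?_
    · refine (hgl _ _ (hSM _ a.2 s) (hSM _ b.2 s)).trans (mul_le_mul_of_nonneg_left ?_ hL.le)
      refine seg_sub_norm_le dist_nonneg (hext _).continuousOn (hext _).continuousOn fun r _ => ?_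
      rw [← dist_eq_norm]
      exact ContinuousMap.dist_apply_le_dist _
    · have h2 := mul_le_mul_of_nonneg_left (hmaxh t)
        (mul_nonneg hL.le (dist_nonneg (x := a.1) (y := b.1)))
      have h3 := mul_le_mul_of_nonneg_right hhL (dist_nonneg (x := a.1) (y := b.1))
      push_cast
      linarith
  let y₀ : C(Icc (-(Δ : ℝ)) h, Vec n) := ⟨fun t => X₀ t, hX₀.comp continuous_subtype_val⟩
  have hy₀ : y₀ ∈ S := fun t => by simp [y₀]
  obtain ⟨y, hyS, hy, -⟩ := hcontr.exists_fixedPoint' hS.isComplete hmaps hy₀ (edist_ne_top _ _)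
  have hyt : ∀ t : ℝ, -(Δ : ℝ) ≤ t → t ≤ h →
      ext y t = X₀ t + ∫ s in (0 : ℝ)..(max t 0), g (seg Δ (ext y) s) := by
    intro t h1 h2
    have h3 : ext y t = y ⟨t, h1, h2⟩ := by simp only [ext]; rw [projIcc_of_mem hΔh ⟨h1, h2⟩]
    have h4 : y ⟨t, h1, h2⟩ = Φ y ⟨t, h1, h2⟩ := by rw [hy.eq]
    rw [h3, h4]; rfl
  have hneg : ∀ t : ℝ, -(Δ : ℝ) ≤ t → t ≤ 0 → ext y t = X₀ t := fun t h1 h2 => by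
    rw [hyt t h1 (h2.trans hh.le), max_eq_right h2, intervalIntegral.integral_same, add_zero]
  refine ⟨h, ext y, by exact_mod_cast hh, (hext y).continuousOn, fun τ => ?_,
    fun t _ _ => (hgs y).intervalIntegrable _ _, fun t ht hth => ?_⟩
  · rw [hneg τ.1 τ.2.1 τ.2.2]
    simp only [X₀]
    rw [projIcc_of_mem hΔ0 τ.2]
  · rw [hyt t (by linarith) (EReal.coe_lt_coe_iff.1 hth).le, hneg 0 hΔ0 le_rfl, max_eq_left ht]
    congr 1
    simp only [X₀]
    rw [projIcc_of_right_le hΔ0 ht, projIcc_right]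

/-- The deviation of the vector field caused by an input is bounded by a product of a function of
the state bound and a class `𝒩` function of the input. -/
theorem LipOnBounded.exists_input_bound (hf : LipOnBounded f) :
    ∃ (N κ : ℝ → ℝ), (∀ r, 0 ≤ N r) ∧ ClassN κ ∧ ∀ (r : ℝ) (φ : Hist Δ n) (v : Vec m),
      ‖φ‖ ≤ r → ‖f φ v - f φ 0‖ ≤ N r * κ ‖v‖ := by
  choose! L hL hlip using hf
  let M : ℝ → ℝ := fun s => ∑ k ∈ Finset.range (⌈s⌉₊ + 1), L (k + 1)
  have hM0 : ∀ s, 0 ≤ M s := fun s => Finset.sum_nonneg fun k _ => (hL _ (by positivity)).le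
  have hMm : Monotone M := fun a b hab =>
    Finset.sum_le_sum_of_subset_of_nonneg
      (Finset.range_mono (by gcongr))
      fun k _ _ => (hL _ (by positivity)).le
  have hML : ∀ s, L (⌈s⌉₊ + 1) ≤ M s := fun s =>
    Finset.single_le_sum (f := fun k : ℕ => L (k + 1)) (fun k _ => (hL _ (by positivity)).le)
      (Finset.self_mem_range_succ _)
  have hMi : ∀ a b, IntervalIntegrable M volume a b := fun a b => hMm.intervalIntegrable
  let I : ℝ → ℝ := fun s => ∫ τ in (0 : ℝ)..(s + 1), M τ
  have hIM : ∀ s, 0 ≤ s → M s ≤ I s := by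
    intro s hs
    have h1 : I s = (∫ τ in (0 : ℝ)..s, M τ) + ∫ τ in s..(s + 1), M τ :=
      (intervalIntegral.integral_add_adjacent_intervals (hMi _ _) (hMi _ _)).symm
    have h2 : 0 ≤ ∫ τ in (0 : ℝ)..s, M τ := intervalIntegral.integral_nonneg hs fun _ _ => hM0 _
    have h3 : ∫ _ in s..(s + 1), M s ≤ ∫ τ in s..(s + 1), M τ :=
      intervalIntegral.integral_mono_on (by linarith) intervalIntegrable_const (hMi _ _)
        fun τ hτ => hMm hτ.1
    simp at h3
    linarith
  have hIm : ∀ a b, a ≤ b → I a ≤ I b := by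
    intro a b hab
    have h1 : (∫ τ in (0 : ℝ)..(a + 1), M τ) + (∫ τ in (a + 1)..(b + 1), M τ) = I b :=
      intervalIntegral.integral_add_adjacent_intervals (hMi _ _) (hMi _ _)
    have h2 : 0 ≤ ∫ τ in (a + 1)..(b + 1), M τ :=
      intervalIntegral.integral_nonneg (by linarith) fun _ _ => hM0 _
    simp only [I] at h1 ⊢
    linarith
  have hIc : Continuous I := (intervalIntegral.continuous_primitive hMi 0).comp (by fun_prop)
  refine ⟨fun r => 1 + M r, fun s => s * (1 + I s), fun r => add_nonneg zero_le_one (hM0 r),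
    ⟨by fun_prop, fun a ha b hb hab => ?_, by simp⟩, fun r φ v hφ => ?_⟩
  · exact mul_le_mul hab (by linarith [hIm a b hab])
      (by linarith [hM0 a, hIM a ha]) hb
  · have hv := norm_nonneg v
    set s := max r ‖v‖
    have hs : s ≤ (⌈s⌉₊ + 1 : ℝ) := (Nat.le_ceil s).trans (by linarith)
    have hpos : (0 : ℝ) < ⌈s⌉₊ + 1 := by positivity
    have h1 := hlip _ hpos φ φ v 0 (hφ.trans ((le_max_left _ _).trans hs))
      (hφ.trans ((le_max_left _ _).trans hs)) ((le_max_right _ _).trans hs) (by simpa using hpos.le)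
    simp only [sub_self, norm_zero, zero_add, sub_zero] at h1
    have h2 : M s ≤ M r + M ‖v‖ := by
      rcases max_choice r ‖v‖ with h | h
      · simp only [s, h]; linarith [hM0 ‖v‖]
      · simp only [s, h]; linarith [hM0 r]
    have h3 : M r + M ‖v‖ ≤ (1 + M r) * (1 + I ‖v‖) := by
      have h4 := hIM ‖v‖ hv
      nlinarith [hM0 r, hM0 ‖v‖]
    calc ‖f φ v - f φ 0‖ ≤ L (⌈s⌉₊ + 1) * ‖v‖ := h1
      _ ≤ (1 + M r) * (1 + I ‖v‖) * ‖v‖ :=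
        mul_le_mul_of_nonneg_right ((hML s).trans (h2.trans h3)) hv
      _ = _ := by ring

/-- Comparison of a solution with the input-free solution from the same initial state. -/
theorem IsSolution.norm_sub_zero_input_le {u : ℝ → Vec m} {x₀ : Hist Δ n} {x z : ℝ → Vec n}
    (hu : IsInput u) (hx : IsSolution Δ f u x₀ ⊤ x) (hz : IsSolution Δ f (fun _ => 0) x₀ ⊤ z)
    {T R L N : ℝ} {κ : ℝ → ℝ} (hT : 0 ≤ T) (hL : 0 ≤ L) (hN : 0 ≤ N) (hκ : ClassN κ)
    (hx₀R : ‖x₀‖ ≤ R) (hxR : ∀ t ∈ Icc 0 T, ‖x t‖ ≤ R) (hzR : ∀ t ∈ Icc 0 T, ‖z t‖ ≤ R)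
    (hlip : ∀ φ ψ : Hist Δ n, ‖φ‖ ≤ R → ‖ψ‖ ≤ R → ‖f φ 0 - f ψ 0‖ ≤ L * ‖φ - ψ‖)
    (hin : ∀ (φ : Hist Δ n) (v : Vec m), ‖φ‖ ≤ R → ‖f φ v - f φ 0‖ ≤ N * κ ‖v‖) :
    ‖x T - z T‖ ≤ N * Real.exp (L * T) * energy κ u T := by
  have hΔ := Δ.coe_nonneg
  have hR : 0 ≤ R := (norm_nonneg _).trans hx₀R
  have hcx : ∀ a t : ℝ, -(Δ : ℝ) ≤ a → ContinuousOn x (Icc a t) := fun a t ha =>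
    hx.continuousOn_Icc ha (EReal.coe_lt_top t)
  have hcz : ∀ a t : ℝ, -(Δ : ℝ) ≤ a → ContinuousOn z (Icc a t) := fun a t ha =>
    hz.continuousOn_Icc ha (EReal.coe_lt_top t)
  have hsegR : ∀ {y : ℝ → Vec n}, (∀ a t : ℝ, -(Δ : ℝ) ≤ a → ContinuousOn y (Icc a t)) →
      (∀ τ : Icc (-(Δ : ℝ)) (0 : ℝ), y τ.1 = x₀ τ) → (∀ t ∈ Icc 0 T, ‖y t‖ ≤ R) →
      ∀ s ∈ Icc 0 T, ‖seg Δ y s‖ ≤ R := by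
    intro y hc hi hb s hs
    refine seg_norm_le hR (hc _ _ (by linarith [hs.1])) fun r hr => ?_
    rcases le_total r 0 with h | h
    · rw [hi ⟨r, by linarith [hr.1, hs.1], h⟩]
      exact (x₀.norm_coe_le_norm _).trans hx₀R
    · exact hb r ⟨h, hr.2.trans hs.2⟩
  let w : ℝ → ℝ := IccExtend hT fun s : Icc 0 T => ‖seg Δ x s - seg Δ z s‖
  have hw : ∀ s ∈ Icc 0 T, w s = ‖seg Δ x s - seg Δ z s‖ := fun s hs => IccExtend_of_mem hT _ hs
  have hwc : Continuous w := by
    refine Continuous.Icc_extend' ?_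
    exact ((continuousOn_seg (hcx _ T le_rfl)).sub (continuousOn_seg (hcz _ T le_rfl))).norm.domRestrict
  have hw0 : ∀ s, 0 ≤ w s := fun s => norm_nonneg _
  let A : ℝ → ℝ := fun t => N * energy κ u T + L * ∫ s in (0 : ℝ)..t, w s
  have hAd : ∀ t, HasDerivAt A (L * w t) t := fun t =>
    ((hwc.integral_hasStrictDerivAt 0 t).hasDerivAt.const_mul L).const_add _
  have hA0 : ∀ t, 0 ≤ t → 0 ≤ A t := fun t ht =>
    add_nonneg (mul_nonneg hN (energy_nonneg hκ hT))
      (mul_nonneg hL (intervalIntegral.integral_nonneg ht fun _ _ => hw0 _))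
  have hAm : ∀ s t, s ≤ t → A s ≤ A t := fun s t hst =>
    (monotone_of_hasDerivAt_nonneg hAd fun t => mul_nonneg hL (hw0 t)) hst
  have hdiff : ∀ t ∈ Icc 0 T, ‖x t - z t‖ ≤ A t := by
    intro t ht
    have hix := hx.integrable t ht.1 (EReal.coe_lt_top t)
    have hiz := hz.integrable t ht.1 (EReal.coe_lt_top t)
    have h0 : x 0 = z 0 := by
      have h1 := hx.init ⟨0, by linarith, le_rfl⟩
      rw [← hz.init ⟨0, by linarith, le_rfl⟩] at h1
      exact h1
    rw [hx.integral_eq t ht.1 (EReal.coe_lt_top t), hz.integral_eq t ht.1 (EReal.coe_lt_top t), h0,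
      add_sub_add_left_eq_sub, ← intervalIntegral.integral_sub hix hiz]
    have hiκ := hu.intervalIntegrable hκ le_rfl ht.1
    have hiw := hwc.intervalIntegrable (μ := volume) 0 t
    have hbound : ‖∫ s in (0 : ℝ)..t, (f (seg Δ x s) (u s) - f (seg Δ z s) 0)‖ ≤
        ∫ s in (0 : ℝ)..t, (N * κ ‖u s‖ + L * w s) := by
      refine intervalIntegral.norm_integral_le_of_norm_le ht.1
        (Eventually.of_forall fun s hs => ?_) ((hiκ.const_mul N).add (hiw.const_mul L))
      have hsT : s ∈ Icc 0 T := ⟨hs.1.le, hs.2.trans ht.2⟩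
      have hxs := hsegR hcx hx.init hxR s hsT
      have hzs := hsegR hcz hz.init hzR s hsT
      rw [hw s hsT]
      exact (norm_sub_le_norm_sub_add_norm_sub _ (f (seg Δ x s) 0) _).trans
        (add_le_add (hin _ _ hxs) (hlip _ _ hxs hzs))
    rw [intervalIntegral.integral_add (hiκ.const_mul N) (hiw.const_mul L),
      intervalIntegral.integral_const_mul, intervalIntegral.integral_const_mul] at hbound
    refine hbound.trans (add_le_add_left ?_ _)
    exact mul_le_mul_of_nonneg_left (hu.energy_mono hκ ht.1 ht.2) hN
  have hwA : ∀ t ∈ Icc 0 T, w t ≤ A t := by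
    intro t ht
    rw [hw t ht]
    refine seg_sub_norm_le (hA0 t ht.1) (hcx _ _ (by linarith [ht.1]))
      (hcz _ _ (by linarith [ht.1])) fun s hs => ?_
    rcases le_total s 0 with h | h
    · have hs' : s ∈ Icc (-(Δ : ℝ)) 0 := ⟨by linarith [hs.1, ht.1], h⟩
      rw [hx.init ⟨s, hs'⟩, hz.init ⟨s, hs'⟩, sub_self, norm_zero]
      exact hA0 t ht.1
    · exact (hdiff s ⟨h, hs.2.trans ht.2⟩).trans (hAm s t hs.2)
  have hgr := norm_le_gronwallBound_of_norm_deriv_right_le (f := A) (f' := fun t => L * w t)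
    (δ := N * energy κ u T) (K := L) (ε := 0) (a := 0) (b := T)
    (fun t _ => (hAd t).continuousAt.continuousWithinAt) (fun t _ => (hAd t).hasDerivWithinAt)
    (by
      rw [Real.norm_eq_abs, abs_of_nonneg (hA0 0 le_rfl)]
      simp [A])
    (fun t ht => by
      rw [Real.norm_eq_abs, Real.norm_eq_abs, abs_of_nonneg (hA0 t ht.1),
        abs_of_nonneg (mul_nonneg hL (hw0 t)), add_zero]
      exact mul_le_mul_of_nonneg_left (hwA t ⟨ht.1, ht.2.le⟩) hL)
    T ⟨hT, le_rfl⟩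
  rw [gronwallBound_ε0, sub_zero, Real.norm_eq_abs, abs_of_nonneg (hA0 T hT)] at hgr
  refine (hdiff T ⟨hT, le_rfl⟩).trans (hgr.trans_eq ?_)
  ring

end VectorField

section Trajectories

variable {Δ : ℝ≥0} {n m : ℕ} {f : Hist Δ n → Vec m → Vec n} {u : ℝ → Vec m} {x₀ : Hist Δ n}
  {x : ℝ → Vec n}

/-- A globally defined solution for an admissible input. -/
structure IsTrajectory (Δ : ℝ≥0) {n m : ℕ} (f : Hist Δ n → Vec m → Vec n) (u : ℝ → Vec m)
    (x₀ : Hist Δ n) (x : ℝ → Vec n) : Prop where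
  isInput : IsInput u
  isSolution : IsSolution Δ f u x₀ ⊤ x

theorem IsTrajectory.shift (h : IsTrajectory Δ f u x₀ x) {a : ℝ} (ha : 0 ≤ a) :
    IsTrajectory Δ f (fun s => u (s + a)) (seg Δ x a) fun s => x (s + a) :=
  ⟨h.isInput.shift ha, h.isSolution.shift ha⟩

theorem IsTrajectory.norm_le_of_nonpos (h : IsTrajectory Δ f u x₀ x) {s : ℝ}
    (hs : s ∈ Icc (-(Δ : ℝ)) 0) : ‖x s‖ ≤ ‖x₀‖ :=
  h.isSolution.init ⟨s, hs⟩ ▸ x₀.norm_coe_le_norm _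

theorem IsTrajectory.seg_norm_le (h : IsTrajectory Δ f u x₀ x) {t b : ℝ} (ht : 0 ≤ t) (hb : 0 ≤ b)
    (hx : ∀ s ∈ Icc (t - (Δ : ℝ)) t, ‖x s‖ ≤ b) : ‖seg Δ x t‖ ≤ b :=
  _root_.seg_norm_le hb
    (h.isSolution.continuousOn_Icc (by linarith) (EReal.coe_lt_top t)) hx

theorem isSolution_zero_input_iff {tmax : EReal} :
    IsSolution₀ Δ (fun φ => f φ 0) x₀ tmax x ↔ IsSolution Δ f (fun _ => 0) x₀ tmax x :=
  ⟨fun h => ⟨h.1, h.2, h.3, h.4, h.5⟩, fun h => ⟨h.1, h.2, h.3, h.4, h.5⟩⟩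

theorem isMaxSolution_zero_input_iff {tmax : EReal} :
    IsMaxSolution₀ Δ (fun φ => f φ 0) x₀ tmax x ↔ IsMaxSolution Δ f (fun _ => 0) x₀ tmax x :=
  ⟨fun h => ⟨isSolution_zero_input_iff.1 h.1,
    fun T y hy => h.2 T y (isSolution_zero_input_iff.2 hy)⟩,
   fun h => ⟨isSolution_zero_input_iff.2 h.1,
    fun T y hy => h.2 T y (isSolution_zero_input_iff.1 hy)⟩⟩

/-- Under UBEBS, trajectories with bounded initial states and energies are bounded. -/
theorem exists_bound_of_energy_estimate {α ξ χ : ℝ → ℝ} {c : ℝ} (hα : ClassKinf α)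
    (hξ : ClassKinf ξ)
    (hest : ∀ (u : ℝ → Vec m) (x₀ : Hist Δ n) (x : ℝ → Vec n), IsTrajectory Δ f u x₀ x →
      ∀ t, 0 ≤ t → α ‖x t‖ ≤ ξ ‖x₀‖ + energy χ u t + c) (r e : ℝ) :
    ∃ R : ℝ, 0 ≤ R ∧ ∀ (u : ℝ → Vec m) (x₀ : Hist Δ n) (x : ℝ → Vec n),
      IsTrajectory Δ f u x₀ x → ‖x₀‖ ≤ r → ∀ t, 0 ≤ t → energy χ u t ≤ e → ‖x t‖ ≤ R := by
  obtain ⟨R, hR, hR0⟩ := ((hα.2.eventually_gt_atTop (ξ r + e + c)).and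
    (eventually_ge_atTop 0)).exists
  refine ⟨R, hR0, fun u x₀ x h hr t ht he => ?_⟩
  by_contra! hlt
  have h1 := hα.1.mono hR0 hlt.le
  have h2 := hξ.1.mono (norm_nonneg _) hr
  linarith [hest u x₀ x h t ht]

/-- Trajectories deviate from the decay estimate `β` at most proportionally to the energy of the
input, uniformly on bounded sets and bounded time intervals. -/
def EnergyPerturbationBound (Δ : ℝ≥0) {n m : ℕ} (f : Hist Δ n → Vec m → Vec n)
    (β : ℝ → ℝ → ℝ) (χ : ℝ → ℝ) : Prop :=
  ∀ r e T : ℝ, ∃ C : ℝ, 0 ≤ C ∧ ∀ (u : ℝ → Vec m) (x₀ : Hist Δ n) (x : ℝ → Vec n),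
    IsTrajectory Δ f u x₀ x → ‖x₀‖ ≤ r → ∀ t, 0 ≤ t → t ≤ T → energy χ u t ≤ e →
      ‖x t‖ ≤ β ‖x₀‖ t + C * energy χ u t

theorem energyPerturbationBound_of_bounded {β : ℝ → ℝ → ℝ} {χ κ N : ℝ → ℝ} (hf : LipOnBounded f)
    (hχ : ClassN χ) (hκ : ClassN κ) (hκχ : ∀ s, 0 ≤ s → κ s ≤ χ s) (hN : ∀ r, 0 ≤ N r)
    (hin : ∀ (r : ℝ) (φ : Hist Δ n) (v : Vec m), ‖φ‖ ≤ r → ‖f φ v - f φ 0‖ ≤ N r * κ ‖v‖)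
    (hβ : ∀ x₀ : Hist Δ n, ∃ z, IsSolution Δ f (fun _ => 0) x₀ ⊤ z ∧
      ∀ t, 0 ≤ t → ‖z t‖ ≤ β ‖x₀‖ t)
    (hbdd : ∀ r e : ℝ, ∃ R : ℝ, 0 ≤ R ∧ ∀ (u : ℝ → Vec m) (x₀ : Hist Δ n) (x : ℝ → Vec n),
      IsTrajectory Δ f u x₀ x → ‖x₀‖ ≤ r → ∀ t, 0 ≤ t → energy χ u t ≤ e → ‖x t‖ ≤ R) :
    EnergyPerturbationBound Δ f β χ := by
  intro r e T
  obtain ⟨R₁, hR₁, hb⟩ := hbdd r e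
  let R := max R₁ r + 1
  have hRr : r ≤ R := (le_max_right _ _).trans (le_add_of_nonneg_right zero_le_one)
  have hRR : R₁ ≤ R := (le_max_left _ _).trans (le_add_of_nonneg_right zero_le_one)
  have hR : 0 < R := by
    have := le_max_left R₁ r
    simp only [R]; linarith
  obtain ⟨L, hL, hlip⟩ := hf R hR
  refine ⟨N R * Real.exp (L * T), mul_nonneg (hN R) (Real.exp_pos _).le,
    fun u x₀ x hx hr t ht htT he => ?_⟩
  obtain ⟨z, hz, hzβ⟩ := hβ x₀
  have hztraj : IsTrajectory Δ f (fun _ => 0) x₀ z := ⟨isInput_zero, hz⟩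
  have he0 : 0 ≤ e := (energy_nonneg hχ ht).trans he
  have h1 := hx.isSolution.norm_sub_zero_input_le hx.isInput hz ht hL.le (hN R) hκ (hr.trans hRr)
    (fun s hs => (hb u x₀ x hx hr s hs.1
      ((hx.isInput.energy_mono hχ hs.1 hs.2).trans he)).trans hRR)
    (fun s hs => (hb _ x₀ z hztraj hr s hs.1 (by rwa [energy_zero hχ])).trans hRR)
    (fun φ ψ h1 h2 => by
      simpa using hlip φ ψ 0 0 h1 h2 (by simpa using hR.le) (by simpa using hR.le))
    (hin R)
  have h2 : N R * Real.exp (L * t) * energy κ u t ≤ N R * Real.exp (L * T) * energy χ u t :=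
    mul_le_mul (mul_le_mul_of_nonneg_left
        (Real.exp_le_exp.2 (mul_le_mul_of_nonneg_left htT hL.le)) (hN R))
      (hx.isInput.energy_le_energy hκ hχ hκχ ht) (energy_nonneg hκ ht)
      (mul_nonneg (hN R) (Real.exp_pos _).le)
  linarith [norm_le_norm_add_norm_sub' (x t) (z t), hzβ t ht]

/-- After a suitable time, trajectories with small input energy have entered a given ball. -/
theorem EnergyPerturbationBound.exists_seg_norm_le {β : ℝ → ℝ → ℝ} {χ : ℝ → ℝ}
    (hG : EnergyPerturbationBound Δ f β χ) (hβ : ClassKL β) (hχ : ClassN χ) {r δ : ℝ}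
    (hr : 0 ≤ r) (hδ : 0 < δ) :
    ∃ T e : ℝ, 0 < T ∧ 0 < e ∧ ∀ (u : ℝ → Vec m) (x₀ : Hist Δ n) (x : ℝ → Vec n),
      IsTrajectory Δ f u x₀ x → ‖x₀‖ ≤ r → (energy χ u T ≤ e → ‖seg Δ x T‖ ≤ δ) ∧
        ∀ t, 0 ≤ t → t ≤ T → energy χ u t ≤ e → ‖x t‖ ≤ β ‖x₀‖ t + δ / 2 := by
  have hΔ := Δ.coe_nonneg
  obtain ⟨T₁, hT₁, hT₁0⟩ := (((hβ.2 r hr).2.2.eventually_le_const (half_pos hδ)).and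
    (eventually_gt_atTop 0)).exists
  obtain ⟨C, hC, hG⟩ := hG r 1 (T₁ + Δ)
  have hmain : ∀ (u : ℝ → Vec m) (x₀ : Hist Δ n) (x : ℝ → Vec n),
      IsTrajectory Δ f u x₀ x → ‖x₀‖ ≤ r → ∀ t, 0 ≤ t → t ≤ T₁ + Δ →
        energy χ u t ≤ min 1 (δ / 2 / (C + 1)) → ‖x t‖ ≤ β ‖x₀‖ t + δ / 2 := by
    intro u x₀ x hx hxr t ht htT he
    have h1 := hG u x₀ x hx hxr t ht htT (he.trans (min_le_left _ _))
    have h2 := (le_div_iff₀ (by positivity)).1 (he.trans (min_le_right _ _))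
    have h3 := energy_nonneg (u := u) hχ ht
    linarith
  refine ⟨T₁ + Δ, min 1 (δ / 2 / (C + 1)), by linarith, by positivity,
    fun u x₀ x hx hxr => ⟨fun he => ?_, hmain u x₀ x hx hxr⟩⟩
  refine hx.seg_norm_le (by linarith) hδ.le fun s hs => ?_
  rw [add_sub_cancel_right] at hs
  have hs0 : 0 ≤ s := hT₁0.le.trans hs.1
  have h1 := hmain u x₀ x hx hxr s hs0 hs.2 ((hx.isInput.energy_mono hχ hs0 hs.2).trans he)
  have h2 := (hβ.1 s hs0).mono (norm_nonneg _) hxr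
  have h3 : β r s ≤ β r T₁ := (hβ.2 r hr).2.1 hT₁0.le hs0 hs.1
  linarith

theorem EnergyPerturbationBound.exists_small {β : ℝ → ℝ → ℝ} {χ : ℝ → ℝ}
    (hG : EnergyPerturbationBound Δ f β χ) (hβ : ClassKL β) (hχ : ClassN χ) {ε : ℝ}
    (hε : 0 < ε) :
    ∃ δ : ℝ, 0 < δ ∧ ∀ (u : ℝ → Vec m) (x₀ : Hist Δ n) (x : ℝ → Vec n),
      IsTrajectory Δ f u x₀ x → ‖x₀‖ ≤ δ → ∀ t, 0 ≤ t → energy χ u t ≤ δ → ‖x t‖ ≤ ε := by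
  obtain ⟨d₁, hd₁, hβd₁⟩ := (hβ.1 0 le_rfl).exists_pos_le (half_pos hε)
  let d := min d₁ ε
  have hd : 0 < d := lt_min hd₁ hε
  have hβd : β d 0 ≤ ε / 2 := ((hβ.1 0 le_rfl).mono hd.le (min_le_left _ _)).trans hβd₁
  obtain ⟨T, e, hT, he, hTe⟩ := hG.exists_seg_norm_le hβ hχ hd.le hd
  have key : ∀ k : ℕ, ∀ (u : ℝ → Vec m) (x₀ : Hist Δ n) (x : ℝ → Vec n),
      IsTrajectory Δ f u x₀ x → ‖x₀‖ ≤ d → ∀ t, 0 ≤ t → t ≤ k * T → energy χ u t ≤ e →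
        ‖x t‖ ≤ ε := by
    have hstep : ∀ (u : ℝ → Vec m) (x₀ : Hist Δ n) (x : ℝ → Vec n),
        IsTrajectory Δ f u x₀ x → ‖x₀‖ ≤ d → ∀ t, 0 ≤ t → t ≤ T → energy χ u t ≤ e →
          ‖x t‖ ≤ ε := by
      intro u x₀ x hx hxd t ht htT het
      have h1 := (hTe u x₀ x hx hxd).2 t ht htT het
      have h2 := (hβ.1 t ht).mono (norm_nonneg _) hxd
      have h3 : β d t ≤ β d 0 := (hβ.2 d hd.le).2.1 (mem_Ici.2 le_rfl) ht ht
      linarith [min_le_right d₁ ε]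
    intro k
    induction k with
    | zero =>
      intro u x₀ x hx hxd t ht htk
      exact hstep u x₀ x hx hxd t ht (htk.trans (by simpa using hT.le))
    | succ k ih =>
      intro u x₀ x hx hxd t ht htk het
      rcases le_total t T with h | h
      · exact hstep u x₀ x hx hxd t ht h het
      · have h1 := hx.isInput.energy_add hχ hT.le (sub_nonneg.2 h)
        rw [sub_add_cancel] at h1
        have h2 := energy_nonneg (u := u) hχ hT.le
        have h3 := energy_nonneg (u := fun s => u (s + T)) hχ (sub_nonneg.2 h)
        have h4 := ih _ _ _ (hx.shift hT.le) ((hTe u x₀ x hx hxd).1 (by linarith)) (t - T)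
          (sub_nonneg.2 h) (by push_cast at htk; linarith) (by linarith)
        simpa using h4
  refine ⟨min d e, lt_min hd he, fun u x₀ x hx hx₀ t ht het => ?_⟩
  obtain ⟨k, hk⟩ := exists_nat_ge (t / T)
  exact key k u x₀ x hx (hx₀.trans (min_le_left _ _)) t ht ((div_le_iff₀ hT).1 hk)
    (het.trans (min_le_right _ _))

/-- Uniform attractivity modulo input energy, from a gain estimate without offset. -/
theorem EnergyPerturbationBound.exists_attraction_time {β : ℝ → ℝ → ℝ} {χ ξ H : ℝ → ℝ}
    (hG : EnergyPerturbationBound Δ f β χ) (hβ : ClassKL β) (hχ : ClassN χ) (hξ : ClassKinf ξ)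
    (hH : ClassKinf H)
    (hest : ∀ (u : ℝ → Vec m) (x₀ : Hist Δ n) (x : ℝ → Vec n), IsTrajectory Δ f u x₀ x →
      ∀ t, 0 ≤ t → ‖x t‖ ≤ H (ξ ‖x₀‖ + energy χ u t)) {r ε : ℝ} (hr : 0 < r) (hε : 0 < ε) :
    ∃ T : ℝ, ∀ (u : ℝ → Vec m) (x₀ : Hist Δ n) (x : ℝ → Vec n), IsTrajectory Δ f u x₀ x →
      ‖x₀‖ ≤ r → ∀ t, 0 ≤ t → T ≤ t → ‖x t‖ ≤ ε + H (2 * energy χ u t) := by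
  have hΔ := Δ.coe_nonneg
  obtain ⟨δ, hδ, hδε⟩ := (hH.comp (classKinf_two_mul.comp hξ)).1.exists_pos_le hε
  let R := max r (H (2 * ξ r))
  have hR : 0 ≤ R := hr.le.trans (le_max_left _ _)
  obtain ⟨T, e, hT, he, hTe⟩ := hG.exists_seg_norm_le hβ hχ hR hδ
  have key : ∀ k : ℕ, ∀ (u : ℝ → Vec m) (x₀ : Hist Δ n) (x : ℝ → Vec n),
      IsTrajectory Δ f u x₀ x → ‖x₀‖ ≤ R → ∀ t, 0 ≤ t → k * T ≤ t →
        (∀ s, 0 ≤ s → s ≤ t → ‖x s‖ ≤ R) → energy χ u t < k * e →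
          ‖x t‖ ≤ ε + H (2 * energy χ u t) := by
    intro k
    induction k with
    | zero =>
      intro u x₀ x _ _ t ht _ _ hlt
      have := energy_nonneg (u := u) hχ ht
      simp at hlt
      linarith
    | succ k ih =>
      intro u x₀ x hx hx₀ t ht hkt hb hlt
      push_cast at hkt hlt
      have hk : (0 : ℝ) ≤ k * T := by positivity
      have hTt : T ≤ t := by linarith
      have h1 := hx.isInput.energy_add hχ hT.le (sub_nonneg.2 hTt)
      rw [sub_add_cancel] at h1
      have h2 := energy_nonneg (u := u) hχ hT.le
      have h3 := energy_nonneg (u := fun s => u (s + T)) hχ (sub_nonneg.2 hTt)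
      have hmono : H (2 * energy χ (fun s => u (s + T)) (t - T)) ≤ H (2 * energy χ u t) :=
        hH.1.mono (by linarith) (by linarith)
      rcases le_or_gt (energy χ u T) e with hle | hgt
      · have h4 := hest _ _ _ (hx.shift hT.le) (t - T) (sub_nonneg.2 hTt)
        rw [sub_add_cancel] at h4
        have h5 := hH.1.map_add_le (hξ.1.nonneg (norm_nonneg (seg Δ x T))) h3
        have h6 : H (2 * ξ ‖seg Δ x T‖) ≤ H (2 * ξ δ) :=
          (hH.comp (classKinf_two_mul.comp hξ)).1.mono (norm_nonneg _)
            ((hTe u x₀ x hx hx₀).1 hle)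
        linarith
      · have hseg : ‖seg Δ x T‖ ≤ R := by
          refine hx.seg_norm_le hT.le hR fun s hs => ?_
          rcases le_total s 0 with h | h
          · exact (hx.norm_le_of_nonpos ⟨by linarith [hs.1], h⟩).trans hx₀
          · exact hb s h (hs.2.trans hTt)
        have h4 := ih _ _ _ (hx.shift hT.le) hseg (t - T) (sub_nonneg.2 hTt) (by linarith)
          (fun s hs hst => hb (s + T) (by linarith) (by linarith)) (by linarith)
        rw [sub_add_cancel] at h4
        linarith
  obtain ⟨k, hk⟩ := exists_nat_gt (ξ r / e)
  refine ⟨k * T, fun u x₀ x hx hx₀ t ht hkt => ?_⟩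
  have hξx := hξ.1.mono (norm_nonneg _) hx₀
  have hξ0 := hξ.1.nonneg (norm_nonneg x₀)
  rcases le_or_gt (energy χ u t) (ξ r) with h | h
  · refine key k u x₀ x hx (hx₀.trans (le_max_left _ _)) t ht hkt (fun s hs hst => ?_)
      (h.trans_lt ((div_lt_iff₀ he).1 hk))
    have h1 := hx.isInput.energy_mono hχ hs hst
    have h2 := energy_nonneg (u := u) hχ hs
    exact (hest u x₀ x hx s hs).trans ((hH.1.mono (by linarith) (by linarith)).trans
      (le_max_right _ _))
  · have h1 : H (ξ ‖x₀‖ + energy χ u t) ≤ H (2 * energy χ u t) :=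
      hH.1.mono (add_nonneg hξ0 (energy_nonneg hχ ht)) (by linarith)
    linarith [hest u x₀ x hx t ht]

theorem iISS.gas (h : iISS Δ f) : GAS Δ fun φ => f φ 0 := by
  obtain ⟨β, η, μ, hβ, hη, hμ, h⟩ := h
  refine ⟨β, hβ, fun x₀ tmax x hx => ?_⟩
  obtain ⟨h1, h2⟩ := h x₀ _ tmax x isInput_zero (isMaxSolution_zero_input_iff.1 hx)
  refine ⟨h1, fun t ht => ?_⟩
  simpa [hμ.2.2, hη.2.2] using h2 t ht

theorem iISS.ubebsWith_zero (h : iISS Δ f) : UBEBSwith Δ f 0 := by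
  obtain ⟨β, η, μ, hβ, hη, hμ, h⟩ := h
  have hη' := hη.add_id
  obtain ⟨γ, hγ, hγl, hγr⟩ := hη'.exists_inverse
  have hβ0 : ClassKinf fun s => β s 0 + s := (hβ.1 0 le_rfl).classN.add_id
  have hhalf : ClassKinf fun s : ℝ => s / 2 :=
    ⟨⟨by fun_prop, fun a _ b _ h => div_lt_div_of_pos_right h two_pos, by simp⟩,
      tendsto_id.atTop_div_const two_pos⟩
  refine ⟨fun s => γ (s / 2), fun s => γ (β s 0 + s), fun s => μ s + s, hγ.comp hhalf,
    hγ.comp hβ0, hμ.add_id, fun x₀ u tmax x hu hx => ?_⟩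
  obtain ⟨h1, h2⟩ := h x₀ u tmax x hu hx
  refine ⟨h1, fun t ht => ?_⟩
  have h3 := h2 t ht
  have hE : energy μ u t ≤ energy (fun s => μ s + s) u t :=
    hu.energy_le_energy hμ hμ.add_id.1.classN (fun s hs => by linarith) ht
  have hE0 := energy_nonneg (u := u) hμ ht
  have h4 : β ‖x₀‖ t ≤ β ‖x₀‖ 0 :=
    (hβ.2 _ (norm_nonneg _)).2.1 (mem_Ici.2 le_rfl) ht ht
  have hx₀ := norm_nonneg x₀
  have h5 : 0 ≤ γ (β ‖x₀‖ 0 + ‖x₀‖) := hγ.1.nonneg (hβ0.1.nonneg hx₀)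
  change ‖x t‖ ≤ β ‖x₀‖ t + η (energy μ u t) at h3
  change γ (‖x t‖ / 2) ≤ γ (β ‖x₀‖ 0 + ‖x₀‖) + energy (fun s => μ s + s) u t + 0
  have hxt : 0 ≤ ‖x t‖ / 2 := by positivity
  rcases le_total (η (energy μ u t) + energy μ u t) (β ‖x₀‖ 0 + ‖x₀‖) with hc | hc
  · have := hγ.1.mono (t := β ‖x₀‖ 0 + ‖x₀‖) hxt (by linarith)
    linarith
  · have := hγ.1.mono (t := η (energy μ u t) + energy μ u t) hxt (by linarith)
    rw [hγr _ hE0] at this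
    linarith

theorem iISS_of_gas_of_ubebsWith (hf : LipOnBounded f) (hgas : GAS Δ fun φ => f φ 0) {c : ℝ}
    (hc : 0 ≤ c) (hub : UBEBSwith Δ f c) : iISS Δ f := by
  obtain ⟨β, hβ, hgas⟩ := hgas
  obtain ⟨α, ξ, ζ, hα, hξ, hζ, hub⟩ := hub
  obtain ⟨N, κ, hN, hκ, hin⟩ := hf.exists_input_bound
  let χ : ℝ → ℝ := fun s => ζ s + κ s
  have hχ : ClassN χ := hζ.1.classN.add hκ
  have hdecay : ∀ x₀ : Hist Δ n, ∃ z, IsSolution Δ f (fun _ => 0) x₀ ⊤ z ∧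
      ∀ t, 0 ≤ t → ‖z t‖ ≤ β ‖x₀‖ t := by
    intro x₀
    obtain ⟨T₀, x, hx⟩ := hf.exists_isSolution_zero_input x₀
    obtain ⟨T, z, hz⟩ := exists_isMaxSolution hx
    obtain ⟨rfl, hzβ⟩ := hgas x₀ T z (isMaxSolution_zero_input_iff.2 hz)
    exact ⟨z, hz.1, hzβ⟩
  have hest : ∀ (u : ℝ → Vec m) (x₀ : Hist Δ n) (x : ℝ → Vec n), IsTrajectory Δ f u x₀ x →
      ∀ t, 0 ≤ t → α ‖x t‖ ≤ ξ ‖x₀‖ + energy χ u t + c := by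
    intro u x₀ x hx t ht
    have h1 := (hub x₀ u ⊤ x hx.isInput hx.isSolution.isMaxSolution).2 t ht
    have h2 : energy ζ u t ≤ energy χ u t :=
      hx.isInput.energy_le_energy hζ.1.classN hχ
        (fun s hs => le_add_of_nonneg_right (hκ.nonneg hs)) ht
    simp only [energy] at h2 ⊢
    linarith
  have hG : EnergyPerturbationBound Δ f β χ :=
    energyPerturbationBound_of_bounded hf hχ hκ (fun s hs => le_add_of_nonneg_left (hζ.1.nonneg hs))
      hN hin hdecay (exists_bound_of_energy_estimate hα hξ hest)
  let ι := {i : ((ℝ → Vec m) × Hist Δ n × (ℝ → Vec n)) × ℝ //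
    IsTrajectory Δ f i.1.1 i.1.2.1 i.1.2.2 ∧ 0 ≤ i.2}
  obtain ⟨H₀, hH₀, hH₀v⟩ := exists_classKinf_bound (ι := ι)
    (p := fun i => ξ ‖i.1.1.2.1‖ + energy χ i.1.1.1 i.1.2) (v := fun i => α ‖i.1.1.2.2 i.1.2‖)
    (fun i => add_nonneg (hξ.1.nonneg (norm_nonneg _)) (energy_nonneg hχ i.2.2)) hc
    (fun i => hest _ _ _ i.2.1 _ i.2.2) (fun ε hε => by
      obtain ⟨ε', hε', hαε⟩ := hα.1.exists_pos_le hε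
      obtain ⟨δ, hδ, hsmall⟩ := hG.exists_small hβ hχ hε'
      refine ⟨min (ξ δ) δ, lt_min (hξ.1.pos hδ) hδ, fun i hi => ?_⟩
      have h1 := hξ.1.nonneg (norm_nonneg i.1.1.2.1)
      have h2 := energy_nonneg (u := i.1.1.1) hχ i.2.2
      have h3 : ‖i.1.1.2.1‖ ≤ δ := by
        by_contra! hlt
        have := hξ.1.2.1 hδ.le (norm_nonneg _) hlt
        linarith [min_le_left (ξ δ) δ]
      refine (hα.1.mono (norm_nonneg _) (hsmall _ _ _ i.2.1 h3 _ i.2.2 ?_)).trans hαε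
      linarith [min_le_right (ξ δ) δ])
  obtain ⟨γ, hγ, -, hγr⟩ := hα.exists_inverse
  let H : ℝ → ℝ := fun s => γ (H₀ s)
  have hH : ClassKinf H := hγ.comp hH₀
  have hHest : ∀ (u : ℝ → Vec m) (x₀ : Hist Δ n) (x : ℝ → Vec n), IsTrajectory Δ f u x₀ x →
      ∀ t, 0 ≤ t → ‖x t‖ ≤ H (ξ ‖x₀‖ + energy χ u t) := by
    intro u x₀ x hx t ht
    have h1 := hH₀v ⟨((u, x₀, x), t), hx, ht⟩
    have h2 := hγ.1.mono (hα.1.nonneg (norm_nonneg (x t))) h1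
    rwa [hγr _ (norm_nonneg _)] at h2
  have hη : ClassKinf fun s => H (2 * s) := hH.comp classKinf_two_mul
  obtain ⟨β', hβ', hv⟩ := exists_classKL_bound (ι := ι) (p := fun i => ‖i.1.1.2.1‖)
    (τ := fun i => i.1.2) (v := fun i => ‖i.1.1.2.2 i.1.2‖ - H (2 * energy χ i.1.1.1 i.1.2))
    (hη.comp hξ) (fun i => norm_nonneg _) (fun i => by
      have h1 := hHest _ _ _ i.2.1 _ i.2.2
      have h2 := hH.1.map_add_le (hξ.1.nonneg (norm_nonneg i.1.1.2.1))
        (energy_nonneg (u := i.1.1.1) hχ i.2.2)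
      linarith) (fun r ε hr hε => by
      obtain ⟨T, hT⟩ := hG.exists_attraction_time hβ hχ hξ hH hHest hr hε
      exact ⟨T, fun i hi hTi => sub_le_iff_le_add.2 (hT _ _ _ i.2.1 hi _ i.2.2 hTi)⟩)
  refine ⟨β', fun s => H (2 * s), χ, hβ', hη.1.classN, hχ, fun x₀ u tmax x hu hx => ?_⟩
  obtain ⟨rfl, -⟩ := hub x₀ u tmax x hu hx
  exact ⟨rfl, fun t ht => sub_le_iff_le_add.1 (hv ⟨((u, x₀, x), t), ⟨hu, hx.1⟩, ht⟩)⟩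

end Trajectories

/-- iISS is equivalent to 0-GAS plus the UBEBS property (with or without
offset). -/
theorem iISS_iff_zero_gas_and_ubebs
    (Δ : ℝ≥0) (n m : ℕ) (f : Hist Δ n → Vec m → Vec n)
    (hf : LipOnBounded f) (hf0 : f 0 0 = 0) :
    List.TFAE
      [iISS Δ f,
       GAS Δ (fun φ => f φ 0) ∧ UBEBSwith Δ f 0,
       GAS Δ (fun φ => f φ 0) ∧ ∃ c : ℝ, 0 ≤ c ∧ UBEBSwith Δ f c] := by
  tfae_have 1 → 2 := fun h => ⟨h.gas, h.ubebsWith_zero⟩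
  tfae_have 2 → 3 := fun h => ⟨h.1, 0, le_rfl, h.2⟩
  tfae_have 3 → 1 := fun ⟨h, _, hc, hub⟩ => iISS_of_gas_of_ubebsWith hf h hc hub
  tfae_finish
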